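/- Let p ∈ (0,1) and let μ be a non-trivial finite Borel measure on the unit sphere S^{n-1} of ℝ^n that is not concentrated on any great subsphere (i.e., there is no (n-1)-dimensional linear subspace L with supp μ ⊂ L ∩ S^{n-1}). Then there exists a convex body K ∈ K_0^n such that μ is the L_p-surface area measure of K, i.e., μ = S_{K,p}. -/

import Mathlib

open MeasureTheory Metric Set Filter
open scoped ENNReal RealInnerProductSpace NNReal

noncomputable section

abbrev Eu (n : ℕ) : Type := EuclideanSpace ℝ (Fin n)

def IsConvexBody {n : ℕ} (K : Set (Eu n)) : Prop :=
  Convex ℝ K ∧ IsCompact K ∧ (interior K).Nonempty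

def suppFn {n : ℕ} (K : Set (Eu n)) (u : Eu n) : ℝ :=
  sSup ((fun x => ⟪x, u⟫) '' K)

def IsOuterNormal {n : ℕ} (K : Set (Eu n)) (x u : Eu n) : Prop :=
  ‖u‖ = 1 ∧ ∀ y ∈ K, ⟪y, u⟫ ≤ ⟪x, u⟫

def gaussMap {n : ℕ} (K : Set (Eu n)) (x : Eu n) : Eu n :=
  open scoped Classical in
  if h : ∃ u, IsOuterNormal K x u then h.choose else 0

def lpSurf {n : ℕ} (p : ℝ) (K : Set (Eu n)) (ω : Set (Eu n)) : ℝ≥0∞ :=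
  ∫⁻ x in {x ∈ frontier K | gaussMap K x ∈ ω},
    ENNReal.ofReal (⟪x, gaussMap K x⟫ ^ (1 - p)) ∂(μH[(n:ℝ) - 1])

open scoped Topology Pointwise

section SupportFunction

variable {n : ℕ} {K : Set (Eu n)}

theorem bddAbove_inner_image (hK : IsCompact K) (u : Eu n) :
    BddAbove ((fun x => ⟪x, u⟫) '' K) :=
  (hK.image (by fun_prop)).bddAbove

theorem inner_le_suppFn (hK : IsCompact K) {x : Eu n} (hx : x ∈ K) (u : Eu n) :
    ⟪x, u⟫ ≤ suppFn K u :=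
  le_csSup (bddAbove_inner_image hK u) ⟨x, hx, rfl⟩

theorem suppFn_le (hne : K.Nonempty) {u : Eu n} {c : ℝ} (h : ∀ x ∈ K, ⟪x, u⟫ ≤ c) :
    suppFn K u ≤ c :=
  csSup_le (hne.image _) (by rintro _ ⟨x, hx, rfl⟩; exact h x hx)

theorem exists_inner_eq_suppFn (hK : IsCompact K) (hne : K.Nonempty) (u : Eu n) :
    ∃ x ∈ K, ⟪x, u⟫ = suppFn K u :=
  (hK.image (by fun_prop : Continuous fun x : Eu n => ⟪x, u⟫)).sSup_mem (hne.image _)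

theorem suppFn_smul (hK : IsCompact K) (hne : K.Nonempty) {s : ℝ} (hs : 0 ≤ s) (u : Eu n) :
    suppFn K (s • u) = s * suppFn K u := by
  obtain ⟨x, hx, hxu⟩ := exists_inner_eq_suppFn hK hne u
  refine le_antisymm (suppFn_le hne fun y hy => ?_) ?_
  · rw [real_inner_smul_right]
    exact mul_le_mul_of_nonneg_left (inner_le_suppFn hK hy u) hs
  · rw [← hxu, ← real_inner_smul_right]
    exact inner_le_suppFn hK hx _

theorem suppFn_le_add {R : ℝ} (hK : IsCompact K) (hne : K.Nonempty)
    (hR : K ⊆ closedBall 0 R) (u v : Eu n) : suppFn K u ≤ suppFn K v + R * ‖u - v‖ := by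
  refine suppFn_le hne fun y hy => ?_
  have h1 : ⟪y, u⟫ = ⟪y, v⟫ + ⟪y, u - v⟫ := by rw [inner_sub_right]; ring
  have h2 := inner_le_suppFn hK hy v
  have h3 := real_inner_le_norm y (u - v)
  have h4 : ‖y‖ ≤ R := by simpa using hR hy
  have h5 := mul_le_mul_of_nonneg_right h4 (norm_nonneg (u - v))
  linarith

theorem continuous_suppFn (hK : IsCompact K) (hne : K.Nonempty) : Continuous (suppFn K) := by
  obtain ⟨R, hR⟩ := hK.isBounded.subset_closedBall (0 : Eu n)
  have : LipschitzWith (Real.toNNReal R) (suppFn K) := by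
    refine LipschitzWith.of_le_add_mul _ fun u v => (suppFn_le_add hK hne hR u v).trans ?_
    rw [dist_eq_norm]
    gcongr
    exact Real.le_coe_toNNReal R
  exact this.continuous

end SupportFunction

section Gauge

variable {n : ℕ} {K : Set (Eu n)}

/-- Compact convex sets containing the origin in their interior. -/
structure IsCenteredBody (K : Set (Eu n)) : Prop where
  convex : Convex ℝ K
  isCompact : IsCompact K
  mem_nhds : K ∈ 𝓝 (0 : Eu n)

namespace IsCenteredBody

theorem zero_mem (hK : IsCenteredBody K) : (0 : Eu n) ∈ K := mem_of_mem_nhds hK.mem_nhds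

theorem nonempty (hK : IsCenteredBody K) : K.Nonempty := ⟨0, hK.zero_mem⟩

theorem absorbent (hK : IsCenteredBody K) : Absorbent ℝ K := absorbent_nhds_zero hK.mem_nhds

theorem exists_ball_subset (hK : IsCenteredBody K) : ∃ r : ℝ, 0 < r ∧ ball 0 r ⊆ K :=
  Metric.mem_nhds_iff.1 hK.mem_nhds

theorem exists_subset_closedBall (hK : IsCenteredBody K) :
    ∃ R : ℝ, 0 < R ∧ K ⊆ closedBall 0 R := by
  obtain ⟨R, hR⟩ := hK.isCompact.isBounded.subset_closedBall (0 : Eu n)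
  exact ⟨max R 1, by positivity, hR.trans (closedBall_subset_closedBall (le_max_left _ _))⟩

theorem gauge_pos (hK : IsCenteredBody K) {x : Eu n} (hx : x ≠ 0) : 0 < gauge K x :=
  (_root_.gauge_pos hK.absorbent
    (NormedSpace.isVonNBounded_iff _ |>.2 hK.isCompact.isBounded)).2 hx

theorem gauge_le_one_iff (hK : IsCenteredBody K) {x : Eu n} : gauge K x ≤ 1 ↔ x ∈ K := by
  rw [gauge_le_one_iff_mem_closure hK.convex hK.mem_nhds, hK.isCompact.isClosed.closure_eq]

theorem gauge_eq_one_iff (hK : IsCenteredBody K) {x : Eu n} : gauge K x = 1 ↔ x ∈ frontier K :=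
  gauge_eq_one_iff_mem_frontier hK.convex hK.mem_nhds

theorem frontier_subset (hK : IsCenteredBody K) : frontier K ⊆ K :=
  hK.isCompact.isClosed.frontier_subset

theorem gauge_smul (_hK : IsCenteredBody K) {s : ℝ} (hs : 0 ≤ s) (x : Eu n) :
    gauge K (s • x) = s * gauge K x := by
  rw [gauge_smul_of_nonneg hs, smul_eq_mul]

theorem gauge_add_le (hK : IsCenteredBody K) (x y : Eu n) :
    gauge K (x + y) ≤ gauge K x + gauge K y :=
  _root_.gauge_add_le hK.convex hK.absorbent x y

theorem continuous_gauge (hK : IsCenteredBody K) : Continuous (gauge K) :=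
  _root_.continuous_gauge hK.convex hK.mem_nhds

theorem ae_differentiableAt_gauge (hK : IsCenteredBody K) :
    ∀ᵐ x ∂(volume : Measure (Eu n)), DifferentiableAt ℝ (gauge K) x := by
  obtain ⟨C, hC⟩ := hK.convex.lipschitz_gauge hK.mem_nhds
  exact hC.ae_differentiableAt

theorem inv_gauge_smul_mem_frontier (hK : IsCenteredBody K) {x : Eu n} (hx : x ≠ 0) :
    (gauge K x)⁻¹ • x ∈ frontier K := by
  have h := hK.gauge_pos hx
  rw [← hK.gauge_eq_one_iff, hK.gauge_smul (by positivity)]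
  field_simp

theorem inner_le_gauge_mul (hK : IsCenteredBody K) {u : Eu n} {c : ℝ}
    (h : ∀ y ∈ K, ⟪y, u⟫ ≤ c) (x : Eu n) : ⟪x, u⟫ ≤ gauge K x * c := by
  rcases eq_or_ne x 0 with rfl | hx
  · simp
  have hg := hK.gauge_pos hx
  have := h _ (hK.frontier_subset (hK.inv_gauge_smul_mem_frontier hx))
  rw [real_inner_smul_left, inv_mul_le_iff₀ hg] at this
  exact this

theorem le_suppFn (hK : IsCenteredBody K) {r : ℝ} (hr : ball 0 r ⊆ K) {u : Eu n}
    (hu : ‖u‖ = 1) : r ≤ suppFn K u := by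
  refine le_of_forall_lt_imp_le_of_dense fun s hs => ?_
  rcases le_or_gt s 0 with h0 | h0
  · have := inner_le_suppFn hK.isCompact hK.zero_mem u
    rw [inner_zero_left] at this
    linarith
  have : s • u ∈ K := hr (by simp [norm_smul, hu, abs_of_pos h0, hs])
  have := inner_le_suppFn hK.isCompact this u
  rwa [real_inner_smul_left, real_inner_self_eq_norm_sq, hu, one_pow, mul_one] at this

theorem suppFn_pos (hK : IsCenteredBody K) {u : Eu n} (hu : ‖u‖ = 1) : 0 < suppFn K u := by
  obtain ⟨r, hr, h⟩ := hK.exists_ball_subset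
  exact hr.trans_le (hK.le_suppFn h hu)

theorem inner_gradient_le (hK : IsCenteredBody K) {x : Eu n}
    (hx : DifferentiableAt ℝ (gauge K) x) (z : Eu n) :
    ⟪z, gradient (gauge K) x⟫ ≤ gauge K z := by
  have h1 : HasDerivAt (fun t : ℝ => gauge K (x + t • z)) (⟪z, gradient (gauge K) x⟫) 0 := by
    have h2 : HasFDerivAt (gauge K) (fderiv ℝ (gauge K) x) (x + (0 : ℝ) • z) := by
      simpa using hx.hasFDerivAt
    have h3 : HasDerivAt (fun t : ℝ => x + t • z) z 0 := by
      simpa using ((hasDerivAt_id (0 : ℝ)).smul_const z).const_add x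
    have := h2.comp_hasDerivAt (0 : ℝ) h3
    rw [real_inner_comm, inner_gradient_left]
    exact this
  have h4 := h1.tendsto_slope_zero_right
  refine le_of_tendsto h4 (eventually_mem_nhdsWithin.mono fun t ht => ?_)
  have ht : 0 < t := ht
  simp only [zero_add, zero_smul, add_zero, smul_eq_mul]
  rw [inv_mul_le_iff₀ ht]
  have := hK.gauge_add_le x (t • z)
  rw [hK.gauge_smul ht.le] at this
  linarith

theorem inner_gradient_self (hK : IsCenteredBody K) {x : Eu n}
    (hx : DifferentiableAt ℝ (gauge K) x) :
    ⟪x, gradient (gauge K) x⟫ = gauge K x := by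
  have h2 : HasFDerivAt (gauge K) (fderiv ℝ (gauge K) x) ((1 : ℝ) • x) := by
    simpa using hx.hasFDerivAt
  have h3 : HasDerivAt (fun t : ℝ => t • x) x 1 := by
    simpa using ((hasDerivAt_id (1 : ℝ)).smul_const x)
  have h4 := h2.comp_hasDerivAt (1 : ℝ) h3
  have h5 : HasDerivAt (fun t : ℝ => t * gauge K x) (gauge K x) 1 := by
    simpa using (hasDerivAt_id (1 : ℝ)).mul_const (gauge K x)
  have h6 : (fun t : ℝ => t * gauge K x) =ᶠ[𝓝 1] gauge K ∘ fun t : ℝ => t • x := by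
    filter_upwards [lt_mem_nhds (zero_lt_one (α := ℝ))] with t ht
    simp [hK.gauge_smul ht.le]
  rw [real_inner_comm, inner_gradient_left]
  exact (h4.congr_of_eventuallyEq h6).unique h5

theorem eq_gradient (_hK : IsCenteredBody K) {x : Eu n} (hx : DifferentiableAt ℝ (gauge K) x)
    {u : Eu n} (hu : ∀ z, ⟪z, u⟫ ≤ gauge K z) (hxu : ⟪x, u⟫ = gauge K x) :
    u = gradient (gauge K) x := by
  have hmin : IsLocalMin (fun z => gauge K z - ⟪u, z⟫) x := by
    refine Filter.Eventually.of_forall fun z => ?_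
    have := hu z
    simp only [real_inner_comm z u, real_inner_comm x u, hxu]
    linarith
  have hd : HasFDerivAt (fun z => gauge K z - ⟪u, z⟫)
      (fderiv ℝ (gauge K) x - innerSL ℝ u) x :=
    hx.hasFDerivAt.sub (innerSL ℝ u).hasFDerivAt
  have h0 := hmin.hasFDerivAt_eq_zero hd
  refine ext_inner_right ℝ fun v => ?_
  have := congrArg (fun L => L v) h0
  simp only [_root_.sub_apply, innerSL_apply_apply, _root_.zero_apply] at this
  rw [inner_gradient_left]
  linarith

end IsCenteredBody

end Gauge

section Polar

open Measure

variable {n : ℕ}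

theorem lintegral_eq_lintegral_sphere_prod {F : Eu (n + 1) → ℝ≥0∞} (hF : Measurable F) :
    ∫⁻ x, F x = ∫⁻ θ, ∫⁻ s, F (s.1 • θ.1) ∂(volumeIoiPow n)
      ∂(volume : Measure (Eu (n + 1))).toSphere := by
  have hd : Module.finrank ℝ (Eu (n + 1)) - 1 = n := by simp
  have hmp := (volume : Measure (Eu (n + 1))).measurePreserving_homeomorphUnitSphereProd
  rw [hd] at hmp
  have hG : Measurable fun y : sphere (0 : Eu (n + 1)) 1 × Ioi (0 : ℝ) => F (y.2.1 • y.1.1) :=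
    hF.comp (by fun_prop)
  rw [← lintegral_prod (μ := (volume : Measure (Eu (n + 1))).toSphere) (ν := volumeIoiPow n)
    (fun y => F (y.2.1 • y.1.1)) hG.aemeasurable, ← hmp.lintegral_comp hG]
  have h0 : ∀ x : ({0}ᶜ : Set (Eu (n + 1))),
      F ((homeomorphUnitSphereProd (Eu (n + 1)) x).2.1 •
        (homeomorphUnitSphereProd (Eu (n + 1)) x).1.1) = F x.1 := by
    intro x
    have hx : ‖x.1‖ ≠ 0 := norm_ne_zero_iff.2 x.2
    simp [smul_smul, hx]
  simp only [h0]
  rw [lintegral_subtype_comap (measurableSet_singleton _).compl, restrict_compl_singleton]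

theorem volume_norm_lt_homogeneous {q : Eu (n + 1) → ℝ} (hq : Measurable q) (hq0 : ∀ x, 0 ≤ q x)
    (hom : ∀ s : ℝ, 0 < s → ∀ x, q (s • x) = q x) :
    volume {x | ‖x‖ < q x} = ∫⁻ x in ball 0 1, ENNReal.ofReal (q x ^ (n + 1)) := by
  have hS : MeasurableSet {x : Eu (n + 1) | ‖x‖ < q x} := measurableSet_lt measurable_norm hq
  have hB : MeasurableSet (ball (0 : Eu (n + 1)) 1) := measurableSet_ball
  rw [← lintegral_indicator_one hS, ← lintegral_indicator hB,
    lintegral_eq_lintegral_sphere_prod (measurable_one.indicator hS),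
    lintegral_eq_lintegral_sphere_prod ((by fun_prop : Measurable fun x =>
      ENNReal.ofReal (q x ^ (n + 1))).indicator hB)]
  refine lintegral_congr fun θ => ?_
  have hθ : ‖(θ : Eu (n + 1))‖ = 1 := by simp
  have hn : ∀ s : Ioi (0 : ℝ), ‖s.1 • (θ : Eu (n + 1))‖ = s.1 := fun s => by
    rw [norm_smul, hθ, mul_one, Real.norm_of_nonneg (le_of_lt s.2)]
  have hR : ∀ s : Ioi (0 : ℝ), (ball (0 : Eu (n + 1)) 1).indicator
      (fun x => ENNReal.ofReal (q x ^ (n + 1))) (s.1 • θ.1) =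
      (Iio (⟨1, mem_Ioi.2 one_pos⟩ : Ioi (0 : ℝ))).indicator
        (fun _ => ENNReal.ofReal (q θ ^ (n + 1))) s := fun s => by
    simp only [indicator, mem_ball_zero_iff, hn, hom s.1 s.2, mem_Iio]
    rfl
  simp only [hR]
  rw [lintegral_indicator measurableSet_Iio, setLIntegral_const, volumeIoiPow_apply_Iio]
  rcases (hq0 θ).eq_or_lt with h0 | h0
  · have hL : ∀ s : Ioi (0 : ℝ), {x : Eu (n + 1) | ‖x‖ < q x}.indicator 1 (s.1 • θ.1) =
        (0 : ℝ≥0∞) := fun s => by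
      refine indicator_of_notMem ?_ _
      simp only [mem_ofPred_eq, hn, hom s.1 s.2, ← h0, not_lt]
      exact le_of_lt s.2
    simp [hL, ← h0]
  · have hL : ∀ s : Ioi (0 : ℝ), {x : Eu (n + 1) | ‖x‖ < q x}.indicator 1 (s.1 • θ.1) =
        (Iio (⟨q θ, h0⟩ : Ioi (0 : ℝ))).indicator (1 : Ioi (0 : ℝ) → ℝ≥0∞) s := fun s => by
      simp only [indicator, mem_ofPred_eq, hn, hom s.1 s.2, mem_Iio]
      rfl
    simp only [hL]
    rw [lintegral_indicator_one measurableSet_Iio, volumeIoiPow_apply_Iio,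
      ← ENNReal.ofReal_mul (by positivity)]
    congr 1
    simp only [one_pow]
    ring

end Polar

section Normal

variable {n : ℕ} {K : Set (Eu n)}

/-- The outer unit normal of `K` at the boundary point on the ray through `x`. -/
def radialNormal (K : Set (Eu n)) (x : Eu n) : Eu n :=
  ‖gradient (gauge K) x‖⁻¹ • gradient (gauge K) x

/-- The boundary point of `K` on the ray through `x`. -/
def radialPoint (K : Set (Eu n)) (x : Eu n) : Eu n := (gauge K x)⁻¹ • x

theorem measurable_gradient (f : Eu n → ℝ) : Measurable (gradient f) := by
  unfold gradient
  exact (LinearIsometryEquiv.continuous _).measurable.comp (measurable_fderiv ℝ f)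

theorem measurable_radialNormal (K : Set (Eu n)) : Measurable (radialNormal K) := by
  unfold radialNormal
  have := measurable_gradient (gauge K)
  fun_prop

namespace IsCenteredBody

theorem measurable_radialPoint (hK : IsCenteredBody K) : Measurable (radialPoint K) := by
  unfold radialPoint
  have := hK.continuous_gauge.measurable
  fun_prop

theorem gradient_ne_zero (hK : IsCenteredBody K) {x : Eu n} (hx0 : x ≠ 0)
    (hx : DifferentiableAt ℝ (gauge K) x) : gradient (gauge K) x ≠ 0 := fun h => by
  have h1 := hK.inner_gradient_self hx
  rw [h, inner_zero_right] at h1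
  exact (hK.gauge_pos hx0).ne h1

theorem norm_radialNormal (hK : IsCenteredBody K) {x : Eu n} (hx0 : x ≠ 0)
    (hx : DifferentiableAt ℝ (gauge K) x) : ‖radialNormal K x‖ = 1 := by
  have := norm_ne_zero_iff.2 (hK.gradient_ne_zero hx0 hx)
  simp [radialNormal, norm_smul, this]

theorem norm_gradient_le (hK : IsCenteredBody K) {r : ℝ} (hr0 : 0 < r) (hr : ball 0 r ⊆ K)
    {x : Eu n} (hx : DifferentiableAt ℝ (gauge K) x) : ‖gradient (gauge K) x‖ ≤ r⁻¹ := by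
  set v := gradient (gauge K) x
  have h1 := hK.inner_gradient_le hx v
  have h2 := mul_gauge_le_norm hr (x := v)
  rw [real_inner_self_eq_norm_sq] at h1
  rcases (norm_nonneg v).eq_or_lt with h | h
  · rw [← h]; positivity
  · rw [le_inv_comm₀ h hr0, ← one_div, le_div_iff₀ h]
    have : r * ‖v‖ ^ 2 ≤ ‖v‖ := (mul_le_mul_of_nonneg_left h1 hr0.le).trans h2
    nlinarith

theorem isOuterNormal_radialNormal (hK : IsCenteredBody K) {x : Eu n} (hx0 : x ≠ 0)
    (hx : DifferentiableAt ℝ (gauge K) x) :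
    IsOuterNormal K (radialPoint K x) (radialNormal K x) := by
  refine ⟨hK.norm_radialNormal hx0 hx, fun y hy => ?_⟩
  have hg := hK.gauge_pos hx0
  have h1 := (hK.inner_gradient_le hx y).trans (hK.gauge_le_one_iff.2 hy)
  rw [radialPoint, radialNormal, real_inner_smul_left, real_inner_smul_right,
    real_inner_smul_right, hK.inner_gradient_self hx]
  have : (gauge K x)⁻¹ * (‖gradient (gauge K) x‖⁻¹ * gauge K x) =
    ‖gradient (gauge K) x‖⁻¹ * 1 := by field_simp
  rw [this]
  gcongr

theorem suppFn_eq_of_isOuterNormal (hK : IsCompact K) {x u : Eu n} (hx : x ∈ K)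
    (hu : IsOuterNormal K x u) : suppFn K u = ⟪x, u⟫ :=
  le_antisymm (suppFn_le ⟨x, hx⟩ hu.2) (inner_le_suppFn hK hx u)

/-- An outer normal `u` at the boundary point over `x` is determined by the gradient. -/
theorem smul_eq_gradient (hK : IsCenteredBody K) {x u : Eu n}
    (hx : DifferentiableAt ℝ (gauge K) x) (hu : ‖u‖ = 1)
    (h : ⟪x, u⟫ = gauge K x * suppFn K u) :
    (suppFn K u)⁻¹ • u = gradient (gauge K) x := by
  have hp := hK.suppFn_pos hu
  refine hK.eq_gradient hx (fun z => ?_) ?_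
  · rw [real_inner_smul_right, inv_mul_le_iff₀ hp, mul_comm]
    exact hK.inner_le_gauge_mul (fun y hy => inner_le_suppFn hK.isCompact hy u) z
  · rw [real_inner_smul_right, h]
    field_simp

theorem eq_radialNormal_of_inner_eq (hK : IsCenteredBody K) {x u : Eu n}
    (hx : DifferentiableAt ℝ (gauge K) x) (hu : ‖u‖ = 1)
    (h : ⟪x, u⟫ = gauge K x * suppFn K u) : u = radialNormal K x := by
  have hp := hK.suppFn_pos hu
  rw [radialNormal, ← hK.smul_eq_gradient hx hu h, norm_smul, hu, smul_smul,
    Real.norm_of_nonneg (by positivity)]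
  simp [hp.ne']

theorem eq_radialNormal (hK : IsCenteredBody K) {x u : Eu n} (hx0 : x ≠ 0)
    (hx : DifferentiableAt ℝ (gauge K) x) (hu : IsOuterNormal K (radialPoint K x) u) :
    u = radialNormal K x := by
  refine hK.eq_radialNormal_of_inner_eq hx hu.1 ?_
  have hg := hK.gauge_pos hx0
  rw [suppFn_eq_of_isOuterNormal hK.isCompact
    (hK.frontier_subset (hK.inv_gauge_smul_mem_frontier hx0)) hu,
    real_inner_smul_left]
  field_simp

theorem suppFn_radialNormal (hK : IsCenteredBody K) {x : Eu n} (hx0 : x ≠ 0)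
    (hx : DifferentiableAt ℝ (gauge K) x) :
    suppFn K (radialNormal K x) = ‖gradient (gauge K) x‖⁻¹ := by
  have hg := hK.gauge_pos hx0
  rw [suppFn_eq_of_isOuterNormal hK.isCompact
    (hK.frontier_subset (hK.inv_gauge_smul_mem_frontier hx0))
    (hK.isOuterNormal_radialNormal hx0 hx), radialNormal, real_inner_smul_left,
    real_inner_smul_right, hK.inner_gradient_self hx]
  field_simp

end IsCenteredBody

end Normal

section Flat

variable {m : ℕ}

/-- The factor relating the Hausdorff measure of dimension `m` to Lebesgue measure. -/
def hausdorffRatio (m : ℕ) : ℝ≥0∞ :=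
  (Measure.addHaarScalarFactor (μH[(m : ℝ)] : Measure (Eu m)) volume : ℝ≥0)

theorem hausdorffMeasure_eq_smul_volume (m : ℕ) :
    (μH[(m : ℝ)] : Measure (Eu m)) = hausdorffRatio m • volume :=
  Measure.isAddLeftInvariant_eq_smul _ _

theorem hausdorffRatio_ne_top (m : ℕ) : hausdorffRatio m ≠ ∞ := ENNReal.coe_ne_top

theorem hausdorffRatio_ne_zero (m : ℕ) : hausdorffRatio m ≠ 0 := fun h => by
  have h1 := hausdorffMeasure_eq_smul_volume m
  rw [h, zero_smul] at h1
  have h2 := isOpen_univ.measure_ne_zero (μH[(m : ℝ)] : Measure (Eu m)) univ_nonempty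
  rw [h1] at h2
  exact h2 rfl

/-- The open cone with apex `0` over a set `A` in the hyperplane `⟪x, u⟫ = t`. -/
def openCone (u : Eu m) (t : ℝ) (A : Set (Eu m)) : Set (Eu m) :=
  {x | 0 < ⟪x, u⟫ ∧ ⟪x, u⟫ < t ∧ (t / ⟪x, u⟫) • x ∈ A}

/-- Prepend a coordinate to a vector. -/
def consEu (q : ℝ × Eu m) : Eu (m + 1) := WithLp.toLp 2 (Fin.cons q.1 q.2.ofLp)

theorem measurePreserving_consEu : MeasurePreserving (consEu (m := m)) := by
  have h1 := PiLp.volume_preserving_toLp (Fin (m + 1))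
  have h2 := (volume_preserving_piFinSuccAbove (fun _ : Fin (m + 1) => ℝ) 0).symm
  have h3 : MeasurePreserving (Prod.map id WithLp.ofLp : ℝ × Eu m → ℝ × (Fin m → ℝ)) :=
    (MeasurePreserving.id volume).prod (PiLp.volume_preserving_ofLp (Fin m))
  have h4 := h1.comp (h2.comp h3)
  convert h4 using 1
  funext q
  ext i
  refine Fin.cases ?_ (fun j => ?_) i <;> simp [consEu, MeasurableEquiv.piFinSuccAbove]

theorem isometry_consEu (t : ℝ) : Isometry fun w : Eu m => consEu (t, w) := by
  refine Isometry.of_dist_eq fun x y => ?_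
  simp [EuclideanSpace.dist_eq, consEu, Fin.sum_univ_succ]

theorem smul_consEu (a t : ℝ) (w : Eu m) : a • consEu (t, w) = consEu (a * t, a • w) := by
  ext i
  refine Fin.cases ?_ (fun j => ?_) i <;> simp [consEu]

theorem inner_consEu_single (q : ℝ × Eu m) :
    ⟪consEu q, EuclideanSpace.single 0 1⟫ = q.1 := by
  simp [consEu, EuclideanSpace.inner_single_right]

theorem exists_consEu (x : Eu (m + 1)) : ∃ w : Eu m, consEu (x 0, w) = x :=
  ⟨WithLp.toLp 2 (Fin.tail x.ofLp), by
    ext i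
    refine Fin.cases ?_ (fun j => ?_) i <;> simp [consEu]⟩

theorem measurableSet_openCone (u : Eu m) (t : ℝ) {A : Set (Eu m)} (hA : MeasurableSet A) :
    MeasurableSet (openCone u t A) := by
  have h1 : Measurable fun x : Eu m => ⟪x, u⟫ := by fun_prop
  have h2 : Measurable fun x : Eu m => (t / ⟪x, u⟫) • x := by fun_prop
  exact (measurableSet_lt measurable_const h1).inter
    ((measurableSet_lt h1 measurable_const).inter (h2 hA))

theorem lintegral_Ioo_div_pow {t : ℝ} (ht : 0 < t) :
    ∫⁻ s in Ioo 0 t, ENNReal.ofReal ((s / t) ^ m) = ENNReal.ofReal (t / (m + 1)) := by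
  rw [Measure.restrict_congr_set Ioo_ae_eq_Ioc, ← ofReal_integral_eq_lintegral_ofReal,
    ← intervalIntegral.integral_of_le ht.le]
  · congr 1
    simp_rw [div_pow]
    rw [intervalIntegral.integral_div, integral_pow]
    field_simp
    simp [pow_succ]
  · exact (Continuous.integrableOn_Icc (by fun_prop)).mono_set Ioc_subset_Icc_self
  · filter_upwards [ae_restrict_mem measurableSet_Ioc] with s hs
    have := hs.1
    positivity

theorem volume_openCone_single {t : ℝ} (ht : 0 < t) {A : Set (Eu (m + 1))}
    (hA : MeasurableSet A) :
    volume (openCone (EuclideanSpace.single 0 1) t A) =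
      ENNReal.ofReal (t / (m + 1)) * volume ((fun w : Eu m => consEu (t, w)) ⁻¹' A) := by
  have hm := (measurableSet_openCone (EuclideanSpace.single 0 1) t hA)
  rw [← measurePreserving_consEu.measure_preimage hm.nullMeasurableSet,
    Measure.volume_eq_prod, Measure.prod_apply (measurePreserving_consEu.measurable hm),
    ← lintegral_Ioo_div_pow ht, ← lintegral_mul_const _ (by fun_prop),
    ← lintegral_indicator measurableSet_Ioo]
  congr with s
  by_cases hs : s ∈ Ioo 0 t
  · rw [indicator_of_mem hs]
    have h0 : 0 < s / t := div_pos hs.1 ht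
    have : (Prod.mk s ⁻¹' (consEu ⁻¹' openCone (EuclideanSpace.single 0 1) t A)) =
        (fun w : Eu m => (s / t)⁻¹ • w) ⁻¹' ((fun w : Eu m => consEu (t, w)) ⁻¹' A) := by
      ext w
      have e : t / s * s = t := div_mul_cancel₀ _ hs.1.ne'
      simp [openCone, inner_consEu_single, hs.1, hs.2, smul_consEu, e]
    rw [this, Measure.addHaar_preimage_smul volume (inv_ne_zero h0.ne')]
    rw [inv_pow, inv_inv, finrank_euclideanSpace_fin, abs_of_pos (by positivity)]
  · rw [indicator_of_notMem hs]
    have : (Prod.mk s ⁻¹' (consEu ⁻¹' openCone (EuclideanSpace.single 0 1) t A)) = ∅ := by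
      ext w
      simp only [openCone, mem_preimage, inner_consEu_single, mem_ofPred_eq,
        mem_empty_iff_false, iff_false]
      exact fun h => hs ⟨h.1, h.2.1⟩
    rw [this, measure_empty]

theorem hausdorffMeasure_flat_single {t : ℝ} (ht : 0 < t) {A : Set (Eu (m + 1))}
    (hA : MeasurableSet A) (h : ∀ x ∈ A, ⟪x, EuclideanSpace.single 0 1⟫ = t) :
    μH[(m : ℝ)] A = hausdorffRatio m * ENNReal.ofReal ((m + 1) / t) *
      volume (openCone (EuclideanSpace.single 0 1) t A) := by
  have h1 : (fun w : Eu m => consEu (t, w)) '' ((fun w : Eu m => consEu (t, w)) ⁻¹' A) = A := by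
    refine image_preimage_eq_of_subset fun x hx => ?_
    obtain ⟨w, hw⟩ := exists_consEu x
    have h2 := h x hx
    rw [← hw, inner_consEu_single] at h2
    exact ⟨w, h2 ▸ hw⟩
  rw [volume_openCone_single ht hA, mul_assoc, ← mul_assoc (ENNReal.ofReal _),
    ← ENNReal.ofReal_mul (by positivity)]
  have : ((m : ℝ) + 1) / t * (t / (m + 1)) = 1 := by field_simp
  rw [this, ENNReal.ofReal_one, one_mul]
  conv_lhs => rw [← h1]
  rw [(isometry_consEu t).hausdorffMeasure_image (Or.inl (by positivity)),
    hausdorffMeasure_eq_smul_volume]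
  rfl

/-- The Hausdorff measure of a subset of a hyperplane in terms of the volume of its cone. -/
theorem hausdorffMeasure_flat {u : Eu (m + 1)} (hu : ‖u‖ = 1) {t : ℝ} (ht : 0 < t)
    {A : Set (Eu (m + 1))} (hA : MeasurableSet A) (h : ∀ x ∈ A, ⟪x, u⟫ = t) :
    μH[(m : ℝ)] A = hausdorffRatio m * ENNReal.ofReal ((m + 1) / t) *
      volume (openCone u t A) := by
  set e : Eu (m + 1) := EuclideanSpace.single 0 1
  set ρ : Eu (m + 1) ≃ₗᵢ[ℝ] Eu (m + 1) := (ℝ ∙ (e - u))ᗮ.reflection with hρ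
  have hρe : ρ e = u := Submodule.reflection_sub (by rw [hu]; simp [e])
  have hin : ∀ x, ⟪x, e⟫ = ⟪ρ x, u⟫ := fun x => by rw [← hρe, ρ.inner_map_map]
  have hA' : MeasurableSet (ρ ⁻¹' A) := ρ.continuous.measurable hA
  have h1 := hausdorffMeasure_flat_single ht hA' fun x hx => (hin x).trans (h _ hx)
  have h2 : openCone e t (ρ ⁻¹' A) = ρ ⁻¹' openCone u t A := by
    ext x
    simp [openCone, hin]
  rw [h2, ρ.measurePreserving.measure_preimage (measurableSet_openCone u t hA).nullMeasurableSet]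
    at h1
  rw [← h1]
  exact (ρ.toIsometryEquiv.hausdorffMeasure_preimage _ A).symm

end Flat

section Monotone

variable {n : ℕ} {K L : Set (Eu n)}

theorem exists_unit_of_ne_zero {f : StrongDual ℝ (Eu n)} (hf : f ≠ 0) :
    ∃ u : Eu n, ‖u‖ = 1 ∧ ∃ c : ℝ, 0 < c ∧ ∀ x, f x = c * ⟪x, u⟫ := by
  set w := (InnerProductSpace.toDual ℝ (Eu n)).symm f with hw
  have h0 : w ≠ 0 := by simpa [hw] using hf
  have hn : 0 < ‖w‖ := norm_pos_iff.2 h0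
  refine ⟨‖w‖⁻¹ • w, by simp [norm_smul, hn.ne'], ‖w‖, hn, fun x => ?_⟩
  rw [real_inner_smul_right, mul_inv_cancel_left₀ hn.ne', real_inner_comm, hw,
    InnerProductSpace.toDual_symm_apply]

theorem exists_isOuterNormal (hK : Convex ℝ K) (hi : (interior K).Nonempty) {x : Eu n}
    (hx : x ∈ frontier K) : ∃ u, IsOuterNormal K x u := by
  obtain ⟨f, hf, h⟩ := geometric_hahn_banach_of_nonempty_interior_point hK hx.2 hi
  obtain ⟨u, hu, c, hc, hfu⟩ := exists_unit_of_ne_zero hf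
  refine ⟨u, hu, fun y hy => ?_⟩
  have := h y hy
  rw [hfu, hfu] at this
  exact le_of_mul_le_mul_left this hc

namespace IsCenteredBody

theorem interior_nonempty (hK : IsCenteredBody K) : (interior K).Nonempty :=
  ⟨0, mem_interior_iff_mem_nhds.2 hK.mem_nhds⟩

theorem exists_isOuterNormal (hK : IsCenteredBody K) {x : Eu n} (hx : x ∈ frontier K) :
    ∃ u, IsOuterNormal K x u :=
  _root_.exists_isOuterNormal hK.convex hK.interior_nonempty hx

theorem exists_add_smul_mem_frontier (hL : IsCenteredBody L) {x u : Eu n} (hx : x ∈ L)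
    (hu : ‖u‖ = 1) : ∃ s : ℝ, 0 ≤ s ∧ x + s • u ∈ frontier L := by
  obtain ⟨R, hR0, hR⟩ := hL.exists_subset_closedBall
  have hc : Continuous fun s : ℝ => gauge L (x + s • u) :=
    hL.continuous_gauge.comp (by fun_prop)
  have h1 : (1 : ℝ) ∈ Icc (gauge L (x + (0 : ℝ) • u)) (gauge L (x + (R + ‖x‖) • u)) := by
    refine ⟨by simpa using hL.gauge_le_one_iff.2 hx, ?_⟩
    refine le_trans ?_ (le_gauge_of_subset_closedBall hL.absorbent hR0.le hR)
    rw [one_le_div hR0]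
    have h2 := norm_sub_norm_le ((R + ‖x‖) • u) (-x)
    rw [norm_smul, hu, norm_neg, Real.norm_of_nonneg (by positivity), sub_neg_eq_add,
      add_comm _ x] at h2
    linarith
  obtain ⟨s, hs, hs1⟩ := intermediate_value_Icc (by positivity) hc.continuousOn h1
  exact ⟨s, hs.1, hL.gauge_eq_one_iff.1 hs1⟩

/-- Surface area is monotone under inclusion of convex bodies. -/
theorem hausdorffMeasure_frontier_mono (hK : IsCenteredBody K) (hL : IsCenteredBody L)
    (hKL : K ⊆ L) {d : ℝ} (hd : 0 ≤ d) : μH[d] (frontier K) ≤ μH[d] (frontier L) := by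
  choose u hu using fun x : frontier K => hK.exists_isOuterNormal x.2
  choose s hs0 hs using fun x : frontier K =>
    hL.exists_add_smul_mem_frontier (hKL (hK.frontier_subset x.2)) (hu x).1
  have ha : AntilipschitzWith 1 fun x : frontier K => (x : Eu n) + s x • u x := by
    refine AntilipschitzWith.of_le_mul_dist fun x y => ?_
    rw [NNReal.coe_one, one_mul, dist_eq_norm, Subtype.dist_eq, dist_eq_norm]
    have h1 := (hu x).2 y (hK.frontier_subset y.2)
    have h2 := (hu y).2 x (hK.frontier_subset x.2)
    have e : (x : Eu n) + s x • u x - (y + s y • u y) = (x - y) + (s x • u x - s y • u y) := by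
      abel
    have h3 : 0 ≤ ⟪(x : Eu n) - y, s x • u x - s y • u y⟫ := by
      simp only [inner_sub_left, inner_sub_right, real_inner_smul_right]
      nlinarith [mul_nonneg (hs0 x) (sub_nonneg.2 h1), mul_nonneg (hs0 y) (sub_nonneg.2 h2)]
    rw [e]
    refine le_of_sq_le_sq ?_ (norm_nonneg _)
    rw [norm_add_sq_real]
    nlinarith [sq_nonneg ‖s x • u x - s y • u y‖]
  have h1 := ha.le_hausdorffMeasure_image hd univ
  rw [ENNReal.coe_one, ENNReal.one_rpow, one_mul,
    ← (isometry_subtype_coe (s := frontier K)).hausdorffMeasure_image (Or.inl hd),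
    image_univ, Subtype.range_coe] at h1
  refine h1.trans (measure_mono ?_)
  rintro _ ⟨x, -, rfl⟩
  exact hs x

theorem smul (hK : IsCenteredBody K) {s : ℝ} (hs : s ≠ 0) : IsCenteredBody (s • K) where
  convex := hK.convex.smul s
  isCompact := hK.isCompact.smul s
  mem_nhds := (set_smul_mem_nhds_zero_iff hs).2 hK.mem_nhds

theorem mem_smul_iff (hK : IsCenteredBody K) {s : ℝ} (hs : 0 < s) {x : Eu n} :
    x ∈ s • K ↔ gauge K x ≤ s := by
  rw [mem_smul_set_iff_inv_smul_mem₀ hs.ne', ← hK.gauge_le_one_iff,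
    hK.gauge_smul (by positivity), inv_mul_le_one₀ hs]

end IsCenteredBody

theorem hausdorffMeasure_frontier_smul {s : ℝ} (hs : s ≠ 0) {d : ℝ} (hd : 0 ≤ d) :
    μH[d] (frontier (s • K)) = (‖s‖₊ : ℝ≥0∞) ^ d * μH[d] (frontier K) := by
  have : frontier (s • K) = s • frontier K :=
    ((Homeomorph.smulOfNeZero s hs).image_frontier K).symm
  rw [this, Measure.hausdorffMeasure_smul₀ hd hs, ENNReal.smul_def, smul_eq_mul,
    ENNReal.coe_rpow_of_nonneg _ hd]

/-- The intersection of finitely many closed half-spaces. -/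
def closedPolytope (I : Finset (Eu n × ℝ)) : Set (Eu n) := {x | ∀ q ∈ I, ⟪x, q.1⟫ ≤ q.2}

/-- The intersection of finitely many open half-spaces. -/
def openPolytope (I : Finset (Eu n × ℝ)) : Set (Eu n) := {x | ∀ q ∈ I, ⟪x, q.1⟫ < q.2}

theorem convex_closedPolytope (I : Finset (Eu n × ℝ)) : Convex ℝ (closedPolytope I) := by
  intro x hx y hy a b ha hb hab q hq
  rw [inner_add_left, real_inner_smul_left, real_inner_smul_left]
  have : q.2 = a * q.2 + b * q.2 := by rw [← add_mul, hab, one_mul]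
  rw [this]
  exact add_le_add (mul_le_mul_of_nonneg_left (hx q hq) ha)
    (mul_le_mul_of_nonneg_left (hy q hq) hb)

theorem isClosed_closedPolytope (I : Finset (Eu n × ℝ)) : IsClosed (closedPolytope I) := by
  simp only [closedPolytope, Set.ofPred_forall]
  exact isClosed_biInter fun q _ => isClosed_le (by fun_prop) continuous_const

theorem isOpen_openPolytope (I : Finset (Eu n × ℝ)) : IsOpen (openPolytope I) := by
  simp only [openPolytope, Set.ofPred_forall]
  exact isOpen_biInter_finset fun q _ => isOpen_lt (by fun_prop) continuous_const

theorem openPolytope_subset (I : Finset (Eu n × ℝ)) : openPolytope I ⊆ closedPolytope I :=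
  fun _ hx q hq => (hx q hq).le

theorem openPolytope_mem_nhds {I : Finset (Eu n × ℝ)} (hI : ∀ q ∈ I, 0 < q.2) :
    openPolytope I ∈ 𝓝 (0 : Eu n) :=
  (isOpen_openPolytope I).mem_nhds fun q hq => by simpa using hI q hq

/-- A centered body is approximated from outside by polytopes. -/
theorem IsCenteredBody.exists_closedPolytope (hK : IsCenteredBody K) {ε : ℝ} (hε : 0 < ε) :
    ∃ I : Finset (Eu n × ℝ), (∀ q ∈ I, ‖q.1‖ = 1 ∧ 0 < q.2) ∧ K ⊆ closedPolytope I ∧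
      closedPolytope I ⊆ (1 + ε) • K := by
  have hc : IsCompact {x | gauge K x = 1 + ε} := by
    refine (hK.smul (by positivity : 1 + ε ≠ 0)).isCompact.of_isClosed_subset
      (isClosed_eq hK.continuous_gauge continuous_const) fun x hx => ?_
    rw [hK.mem_smul_iff (by positivity)]
    exact hx.le
  have hp : 0 < 1 + ε := by positivity
  choose u hu using fun x : {x | gauge K x = 1 + ε} => hK.exists_isOuterNormal
    (x := (1 + ε)⁻¹ • (x : Eu n)) (hK.gauge_eq_one_iff.1 (by
      rw [hK.gauge_smul (by positivity), x.2, inv_mul_cancel₀ hp.ne']))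
  have hux : ∀ x : {x | gauge K x = 1 + ε}, suppFn K (u x) < ⟪(x : Eu n), u x⟫ := fun x => by
    have h1 : suppFn K (u x) ≤ ⟪(1 + ε)⁻¹ • (x : Eu n), u x⟫ := suppFn_le hK.nonempty (hu x).2
    rw [real_inner_smul_left, le_inv_mul_iff₀ hp] at h1
    nlinarith [hK.suppFn_pos (hu x).1]
  obtain ⟨J, hJ⟩ := hc.elim_nhds_subcover' (fun x hx => {y | suppFn K (u ⟨x, hx⟩) <
    ⟪y, u ⟨x, hx⟩⟫}) fun x hx => (isOpen_lt continuous_const (by fun_prop)).mem_nhds (hux ⟨x, hx⟩)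
  classical
  refine ⟨J.image fun x => (u x, suppFn K (u x)), fun q hq => ?_, fun x hx q hq => ?_,
    fun x hx => ?_⟩
  · obtain ⟨x, -, rfl⟩ := Finset.mem_image.1 hq
    exact ⟨(hu x).1, hK.suppFn_pos (hu x).1⟩
  · obtain ⟨y, -, rfl⟩ := Finset.mem_image.1 hq
    exact inner_le_suppFn hK.isCompact hx _
  · rw [hK.mem_smul_iff hp]
    by_contra! h
    have hg : 0 < gauge K x := hp.trans h
    have h1 : ((1 + ε) / gauge K x) • x ∈ {x | gauge K x = 1 + ε} := by
      rw [mem_ofPred_eq, hK.gauge_smul (by positivity), div_mul_cancel₀ _ hg.ne']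
    obtain ⟨y, hy, hxy⟩ := mem_iUnion₂.1 (hJ h1)
    have h2 := hx _ (Finset.mem_image_of_mem _ hy)
    rw [mem_ofPred_eq, real_inner_smul_left] at hxy
    have h3 : (1 + ε) / gauge K x ≤ 1 := (div_le_one hg).2 h.le
    have h4 : 0 ≤ (1 + ε) / gauge K x := by positivity
    have h5 := hK.suppFn_pos (hu y).1
    change ⟪x, u y⟫ ≤ suppFn K (u y) at h2
    change suppFn K (u y) < _ at hxy
    nlinarith [mul_le_mul_of_nonneg_left h2 h4]

end Monotone

section Boundary

variable {m n : ℕ} {K L : Set (Eu n)}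

/-- The density of the surface area with respect to Lebesgue measure on the unit ball, under
radial projection. -/
def surfaceDensity (K : Set (Eu n)) (x : Eu n) : ℝ :=
  n * (‖x‖ / gauge K x) ^ n * ‖gradient (gauge K) x‖

/-- The measure on the unit ball whose radial projection is the surface area of `K`, up to
normalization. -/
def surfaceMeasure (K : Set (Eu n)) : Measure (Eu n) :=
  (volume.restrict (ball 0 1)).withDensity fun x => ENNReal.ofReal (surfaceDensity K x)

theorem surfaceDensity_nonneg (K : Set (Eu n)) (x : Eu n) : 0 ≤ surfaceDensity K x := by
  have := gauge_nonneg (s := K) x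
  unfold surfaceDensity
  positivity

theorem ae_ne_zero : ∀ᵐ x ∂(volume : Measure (Eu (m + 1))), x ≠ 0 := by
  simp [ae_iff]

namespace IsCenteredBody

theorem measurable_surfaceDensity (hK : IsCenteredBody K) : Measurable (surfaceDensity K) := by
  have h1 := hK.continuous_gauge.measurable
  have h2 := measurable_gradient (gauge K)
  unfold surfaceDensity
  fun_prop

theorem norm_div_gauge_le (hK : IsCenteredBody K) {R : ℝ} (hR0 : 0 < R)
    (hR : K ⊆ closedBall 0 R) (x : Eu n) : ‖x‖ / gauge K x ≤ R := by
  rcases eq_or_ne x 0 with rfl | hx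
  · simpa using hR0.le
  · rw [div_le_comm₀ (hK.gauge_pos hx) hR0]
    exact le_gauge_of_subset_closedBall hK.absorbent hR0.le hR

theorem surfaceDensity_le (hK : IsCenteredBody K) {r R : ℝ} (hr0 : 0 < r) (hr : ball 0 r ⊆ K)
    (hR0 : 0 < R) (hR : K ⊆ closedBall 0 R) {x : Eu n} (hx : DifferentiableAt ℝ (gauge K) x) :
    surfaceDensity K x ≤ n * R ^ n * r⁻¹ := by
  have h1 := hK.norm_div_gauge_le hR0 hR x
  have h2 := hK.norm_gradient_le hr0 hr hx
  have h3 := gauge_nonneg (s := K) x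
  unfold surfaceDensity
  gcongr

theorem isFiniteMeasure_surfaceMeasure (hK : IsCenteredBody K) :
    IsFiniteMeasure (surfaceMeasure K) := by
  obtain ⟨r, hr0, hr⟩ := hK.exists_ball_subset
  obtain ⟨R, hR0, hR⟩ := hK.exists_subset_closedBall
  refine isFiniteMeasure_withDensity ?_
  have : ∫⁻ x in ball (0 : Eu n) 1, ENNReal.ofReal (surfaceDensity K x) ≤
      ∫⁻ x in ball (0 : Eu n) 1, ENNReal.ofReal (n * R ^ n * r⁻¹) := by
    refine lintegral_mono_ae (ae_restrict_of_ae ?_)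
    filter_upwards [hK.ae_differentiableAt_gauge] with x hx
    exact ENNReal.ofReal_le_ofReal (hK.surfaceDensity_le hr0 hr hR0 hR hx)
  refine (this.trans_lt ?_).ne
  rw [setLIntegral_const]
  exact ENNReal.mul_lt_top ENNReal.ofReal_lt_top measure_ball_lt_top

end IsCenteredBody

/-- The surface area measure of the boundary of `K`, obtained by radial projection. -/
def boundaryMeasure (K : Set (Eu n)) : Measure (Eu n) := (surfaceMeasure K).map (radialPoint K)

namespace IsCenteredBody

theorem isFiniteMeasure_boundaryMeasure (hK : IsCenteredBody K) :
    IsFiniteMeasure (boundaryMeasure K) := by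
  have := hK.isFiniteMeasure_surfaceMeasure
  exact Measure.isFiniteMeasure_map _ _

theorem boundaryMeasure_apply (hK : IsCenteredBody K) {A : Set (Eu n)} (hA : MeasurableSet A) :
    boundaryMeasure K A =
      ∫⁻ x in ball 0 1, (radialPoint K ⁻¹' A).indicator
        (fun x => ENNReal.ofReal (surfaceDensity K x)) x := by
  have h := hK.measurable_radialPoint hA
  rw [boundaryMeasure, Measure.map_apply hK.measurable_radialPoint hA, surfaceMeasure,
    withDensity_apply _ h, lintegral_indicator h]

theorem boundaryMeasure_flat {K : Set (Eu (m + 1))} (hK : IsCenteredBody K) {u : Eu (m + 1)}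
    (hu : ‖u‖ = 1) {t : ℝ} (ht : 0 < t) {A : Set (Eu (m + 1))} (hA : MeasurableSet A)
    (hAK : A ⊆ frontier K) (h : ∀ x ∈ A, ⟪x, u⟫ = t) (hKt : ∀ x ∈ K, ⟪x, u⟫ ≤ t) :
    boundaryMeasure K A = ENNReal.ofReal ((m + 1) / t) * volume (openCone u t A) := by
  have hm := hK.measurable_radialPoint hA
  set q : Eu (m + 1) → ℝ := (radialPoint K ⁻¹' A).indicator fun x => ‖x‖ / gauge K x with hq
  have hqm : Measurable q :=
    (measurable_norm.div hK.continuous_gauge.measurable).indicator hm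
  have hq0 : ∀ x, 0 ≤ q x :=
    indicator_nonneg fun x _ => div_nonneg (norm_nonneg x) (gauge_nonneg x)
  have hom : ∀ s : ℝ, 0 < s → ∀ x, q (s • x) = q x := fun s hs x => by
    have h1 : radialPoint K (s • x) = radialPoint K x := by
      rw [radialPoint, radialPoint, hK.gauge_smul hs.le, smul_smul, mul_inv,
        mul_comm s⁻¹, mul_assoc, inv_mul_cancel₀ hs.ne', mul_one]
    have h2 : ‖s • x‖ / gauge K (s • x) = ‖x‖ / gauge K x := by
      rw [norm_smul, hK.gauge_smul hs.le, Real.norm_of_nonneg hs.le, mul_div_mul_left _ _ hs.ne']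
    by_cases hx : radialPoint K x ∈ A
    · rw [hq, indicator_of_mem (show s • x ∈ radialPoint K ⁻¹' A by simpa [h1] using hx),
        indicator_of_mem (show x ∈ radialPoint K ⁻¹' A from hx), h2]
    · rw [hq, indicator_of_notMem (show s • x ∉ radialPoint K ⁻¹' A by simpa [h1] using hx),
        indicator_of_notMem (show x ∉ radialPoint K ⁻¹' A from hx)]
  have hcone : openCone u t A = {x | ‖x‖ < q x} := by
    ext x
    constructor
    · rintro ⟨h0, hlt, hx⟩
      have hx0 : x ≠ 0 := by rintro rfl; simp at h0
      have hg := hK.gauge_eq_one_iff.2 (hAK hx)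
      rw [hK.gauge_smul (by positivity)] at hg
      have hg' : gauge K x = ⟪x, u⟫ / t := by field_simp at hg ⊢; linarith
      have hr : radialPoint K x ∈ A := by rwa [radialPoint, hg', inv_div]
      rw [mem_ofPred_eq, hq, indicator_of_mem (show x ∈ radialPoint K ⁻¹' A from hr),
        lt_div_iff₀ (hK.gauge_pos hx0), hg']
      exact mul_lt_of_lt_one_right (norm_pos_iff.2 hx0) ((div_lt_one ht).2 hlt)
    · intro hx
      have hr : radialPoint K x ∈ A := by
        by_contra hr
        rw [mem_ofPred_eq, hq, indicator_of_notMem (show x ∉ radialPoint K ⁻¹' A from hr)] at hx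
        exact hx.not_ge (norm_nonneg x)
      have hx0 : x ≠ 0 := by
        rintro rfl
        have := h _ hr
        simp [radialPoint] at this
        exact ht.ne this
      have hg := hK.gauge_pos hx0
      rw [mem_ofPred_eq, hq, indicator_of_mem (show x ∈ radialPoint K ⁻¹' A from hr),
        lt_div_iff₀ hg] at hx
      have hg1 : gauge K x < 1 := by
        have := norm_pos_iff.2 hx0
        by_contra! h1
        nlinarith
      have h1 := h _ hr
      rw [radialPoint, real_inner_smul_left, inv_mul_eq_iff_eq_mul₀ hg.ne'] at h1
      refine ⟨by rw [h1]; positivity, by rw [h1]; exact mul_lt_of_lt_one_left ht hg1, ?_⟩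
      rwa [h1, div_mul_cancel_right₀ ht.ne']
  rw [hcone, volume_norm_lt_homogeneous hqm hq0 hom, hK.boundaryMeasure_apply hA,
    ← lintegral_const_mul _ (by fun_prop)]
  refine lintegral_congr_ae (ae_restrict_of_ae ?_)
  filter_upwards [hK.ae_differentiableAt_gauge, ae_ne_zero] with x hx hx0
  by_cases hr : radialPoint K x ∈ A
  · rw [indicator_of_mem (show x ∈ radialPoint K ⁻¹' A from hr), hq,
      indicator_of_mem (show x ∈ radialPoint K ⁻¹' A from hr),
      ← ENNReal.ofReal_mul (by positivity), surfaceDensity]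
    have hs : suppFn K u = t := by
      rw [suppFn_eq_of_isOuterNormal hK.isCompact (hK.frontier_subset (hAK hr))
        ⟨hu, fun y hy => ?_⟩, h _ hr]
      rw [h _ hr]
      exact hKt y hy
    have hg := hK.gauge_pos hx0
    have h1 := h _ hr
    rw [radialPoint, real_inner_smul_left, inv_mul_eq_iff_eq_mul₀ hg.ne'] at h1
    rw [← hK.smul_eq_gradient hx hu (by rw [hs, h1]), hs, norm_smul, hu,
      Real.norm_of_nonneg (by positivity)]
    congr 1
    push_cast
    field_simp
  · rw [indicator_of_notMem (show x ∉ radialPoint K ⁻¹' A from hr), hq,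
      indicator_of_notMem (show x ∉ radialPoint K ⁻¹' A from hr)]
    simp

theorem hausdorffMeasure_restrict_flat {K : Set (Eu (m + 1))} (hK : IsCenteredBody K)
    {I : Finset (Eu (m + 1) × ℝ)} (hI : ∀ q ∈ I, ‖q.1‖ = 1 ∧ 0 < q.2)
    (hKI : K ⊆ closedPolytope I) {B : Set (Eu (m + 1))} (hB : MeasurableSet B)
    (hBK : B ⊆ frontier K) (hBI : ∀ x ∈ B, ∃ q ∈ I, ⟪x, q.1⟫ = q.2) :
    μH[(m : ℝ)] B = hausdorffRatio m * boundaryMeasure K B := by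
  set s : I → Set (Eu (m + 1)) := fun q => B ∩ {x | ⟪x, q.1.1⟫ = q.1.2}
  have hs : ∀ q, MeasurableSet (s q) := fun q =>
    hB.inter (measurableSet_eq_fun (by fun_prop) measurable_const)
  have hU : ⋃ q, s q = B := by
    ext x
    simp only [mem_iUnion]
    refine ⟨fun ⟨q, hq⟩ => hq.1, fun hx => ?_⟩
    obtain ⟨q, hq, h⟩ := hBI x hx
    exact ⟨⟨q, hq⟩, hx, h⟩
  have key := (Measure.restrict_iUnion_congr (μ := μH[(m : ℝ)])
    (ν := hausdorffRatio m • boundaryMeasure K) (s := s)).2 fun q => by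
      ext A hA
      rw [Measure.restrict_apply hA, Measure.restrict_apply hA]
      have hI' := hI _ q.2
      have hm := hA.inter (hs q)
      have h1 : ∀ x ∈ A ∩ s q, ⟪x, q.1.1⟫ = q.1.2 := fun x hx => hx.2.2
      rw [hausdorffMeasure_flat hI'.1 hI'.2 hm h1, Measure.smul_apply,
        hK.boundaryMeasure_flat hI'.1 hI'.2 hm (fun x hx => hBK hx.2.1) h1
          (fun x hx => hKI hx _ q.2), smul_eq_mul, mul_assoc]
  rw [hU] at key
  simpa using congrArg (fun ν => ν univ) key

end IsCenteredBody

end Boundary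

section SurfaceArea

variable {m n : ℕ} {K L : Set (Eu n)}

theorem tendsto_gradient_gauge {ι : Type*} {l : Filter ι} (hK : IsCenteredBody K) {x : Eu n}
    (hx : DifferentiableAt ℝ (gauge K) x) {v : ι → Eu n} {C : ℝ} (hC : ∀ᶠ i in l, ‖v i‖ ≤ C)
    {φ : ι → Eu n → ℝ} (hφ : ∀ z, Tendsto (fun i => φ i z) l (𝓝 (gauge K z)))
    (hv : ∀ᶠ i in l, ∀ z, ⟪z, v i⟫ ≤ φ i z)
    (hvx : Tendsto (fun i => ⟪x, v i⟫) l (𝓝 (gauge K x))) :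
    Tendsto v l (𝓝 (gradient (gauge K) x)) := by
  refine (isCompact_closedBall (0 : Eu n) C).tendsto_nhds_of_unique_mapClusterPt
    (hC.mono fun i hi => by simpa using hi) fun w _ hw => ?_
  obtain ⟨U, hU, hUw⟩ := mapClusterPt_iff_ultrafilter.1 hw
  have hin : ∀ z, Tendsto (fun i => ⟪z, v i⟫) U (𝓝 ⟪z, w⟫) := fun z =>
    tendsto_const_nhds.inner hUw
  refine hK.eq_gradient hx (fun z => ?_) (tendsto_nhds_unique (hin x) (hvx.mono_left hU))
  exact le_of_tendsto_of_tendsto (hin z) ((hφ z).mono_left hU)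
    (Eventually.mono (hU hv) fun i hi => hi z)

theorem tendsto_boundaryMeasure_univ (hK : IsCenteredBody K) {P : ℕ → Set (Eu n)}
    (hP : ∀ j, IsCenteredBody (P j)) {r R : ℝ} (hr0 : 0 < r) (hr : ∀ j, ball 0 r ⊆ P j)
    (hR0 : 0 < R) (hR : ∀ j, P j ⊆ closedBall 0 R)
    (h : ∀ z, Tendsto (fun j => gauge (P j) z) atTop (𝓝 (gauge K z))) :
    Tendsto (fun j => boundaryMeasure (P j) univ) atTop (𝓝 (boundaryMeasure K univ)) := by
  simp only [(hP _).boundaryMeasure_apply MeasurableSet.univ,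
    hK.boundaryMeasure_apply MeasurableSet.univ, preimage_univ, indicator_univ]
  refine tendsto_lintegral_of_dominated_convergence'
    (fun _ => ENNReal.ofReal (n * R ^ n * r⁻¹))
    (fun j => (hP j).measurable_surfaceDensity.ennreal_ofReal.aemeasurable)
    (fun j => ae_restrict_of_ae ?_) ?_ (ae_restrict_of_ae ?_)
  · filter_upwards [(hP j).ae_differentiableAt_gauge] with x hx
    exact ENNReal.ofReal_le_ofReal ((hP j).surfaceDensity_le hr0 (hr j) hR0 (hR j) hx)
  · rw [setLIntegral_const]
    exact (ENNReal.mul_lt_top ENNReal.ofReal_lt_top measure_ball_lt_top).ne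
  · filter_upwards [hK.ae_differentiableAt_gauge,
      ae_all_iff.2 fun j => (hP j).ae_differentiableAt_gauge] with x hx hxj
    refine ENNReal.tendsto_ofReal ?_
    have hg : Tendsto (fun j => gradient (gauge (P j)) x) atTop (𝓝 (gradient (gauge K) x)) :=
      tendsto_gradient_gauge hK hx
        (Eventually.of_forall fun j => (hP j).norm_gradient_le hr0 (hr j) (hxj j)) h
        (Eventually.of_forall fun j z => (hP j).inner_gradient_le (hxj j) z)
        (by simpa only [(hP _).inner_gradient_self (hxj _)] using h x)
    rcases eq_or_ne x 0 with rfl | hx0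
    · simp only [surfaceDensity, gauge_zero, norm_zero, div_zero]
      exact hg.norm.const_mul _
    · exact (((tendsto_const_nhds.div (h x) (hK.gauge_pos hx0).ne').pow n).const_mul _).mul
        hg.norm

theorem gauge_le_gauge_of_subset (hK : IsCenteredBody K) (h : K ⊆ L) (x : Eu n) :
    gauge L x ≤ gauge K x := gauge_mono hK.absorbent h x

theorem IsCenteredBody.inter_closedPolytope (hK : IsCenteredBody K) {I : Finset (Eu n × ℝ)}
    (hI : ∀ q ∈ I, 0 < q.2) : IsCenteredBody (K ∩ closedPolytope I) where
  convex := hK.convex.inter (convex_closedPolytope I)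
  isCompact := hK.isCompact.inter_right (isClosed_closedPolytope I)
  mem_nhds := inter_mem hK.mem_nhds
    (mem_of_superset (openPolytope_mem_nhds hI) (openPolytope_subset I))

theorem frontier_inter_closedPolytope_inter (I : Finset (Eu n × ℝ)) :
    frontier (K ∩ closedPolytope I) ∩ openPolytope I = frontier K ∩ openPolytope I := by
  rw [← frontier_inter_open_inter (isOpen_openPolytope I),
    ← frontier_inter_open_inter (s := K) (isOpen_openPolytope I), inter_assoc,
    inter_eq_right.2 (openPolytope_subset I)]

theorem exists_inner_eq_of_notMem {I : Finset (Eu n × ℝ)} {x : Eu n} (hx : x ∈ closedPolytope I)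
    (hx' : x ∉ openPolytope I) : ∃ q ∈ I, ⟪x, q.1⟫ = q.2 := by
  simp only [openPolytope, mem_ofPred_eq, not_forall, not_lt] at hx'
  obtain ⟨q, hq, h⟩ := hx'
  exact ⟨q, hq, le_antisymm (hx q hq) h⟩

theorem frontier_closedPolytope_subset (I : Finset (Eu n × ℝ)) {x : Eu n}
    (hx : x ∈ frontier (closedPolytope I)) : ∃ q ∈ I, ⟪x, q.1⟫ = q.2 :=
  exists_inner_eq_of_notMem ((isClosed_closedPolytope I).frontier_subset hx) fun h =>
    hx.2 (interior_maximal (openPolytope_subset I) (isOpen_openPolytope I) h)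

theorem IsCenteredBody.boundaryMeasure_compl_frontier {K : Set (Eu (m + 1))}
    (hK : IsCenteredBody K) : boundaryMeasure K (frontier K)ᶜ = 0 := by
  rw [hK.boundaryMeasure_apply isClosed_frontier.measurableSet.compl]
  refine (lintegral_congr_ae (ae_restrict_of_ae ?_)).trans lintegral_zero
  filter_upwards [ae_ne_zero] with x hx
  refine indicator_of_notMem (fun h => ?_) _
  exact h (hK.inv_gauge_smul_mem_frontier hx)

theorem IsCenteredBody.boundaryMeasure_inter_frontier {K : Set (Eu (m + 1))}
    (hK : IsCenteredBody K) (A : Set (Eu (m + 1))) :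
    boundaryMeasure K (A ∩ frontier K) = boundaryMeasure K A :=
  measure_inter_conull' (measure_mono_null (fun _ hx => hx.2) hK.boundaryMeasure_compl_frontier)

theorem hausdorffMeasure_frontier_polytope {I : Finset (Eu (m + 1) × ℝ)}
    (hI : ∀ q ∈ I, ‖q.1‖ = 1 ∧ 0 < q.2) (hP : IsCenteredBody (closedPolytope I)) :
    μH[(m : ℝ)] (frontier (closedPolytope I)) =
      hausdorffRatio m * boundaryMeasure (closedPolytope I) univ := by
  rw [hP.hausdorffMeasure_restrict_flat hI subset_rfl isClosed_frontier.measurableSet subset_rfl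
    fun x => frontier_closedPolytope_subset I, ← hP.boundaryMeasure_inter_frontier univ,
    univ_inter]

/-- The total surface area of a centered body. -/
theorem IsCenteredBody.hausdorffMeasure_frontier {K : Set (Eu (m + 1))} (hK : IsCenteredBody K) :
    μH[(m : ℝ)] (frontier K) = hausdorffRatio m * boundaryMeasure K univ := by
  obtain ⟨r, hr0, hr⟩ := hK.exists_ball_subset
  obtain ⟨R, hR0, hR⟩ := hK.exists_subset_closedBall
  have hε : ∀ j : ℕ, 0 < 1 / ((j : ℝ) + 1) := fun j => by positivity
  have hε1 : ∀ j : ℕ, 1 / ((j : ℝ) + 1) ≤ 1 := fun j => by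
    rw [div_le_one (by positivity)]; linarith [j.cast_nonneg (α := ℝ)]
  have hs : ∀ j : ℕ, 0 < 1 + 1 / ((j : ℝ) + 1) := fun j => by positivity
  have hlim : Tendsto (fun j : ℕ => 1 + 1 / ((j : ℝ) + 1)) atTop (𝓝 1) := by
    simpa using tendsto_one_div_add_atTop_nhds_zero_nat.const_add (1 : ℝ)
  choose I hI hKI hIK using fun j => hK.exists_closedPolytope (hε j)
  have hP : ∀ j, IsCenteredBody (closedPolytope (I j)) := fun j =>
    ⟨convex_closedPolytope _, (hK.smul (hs j).ne').isCompact.of_isClosed_subset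
      (isClosed_closedPolytope _) (hIK j), mem_of_superset hK.mem_nhds (hKI j)⟩
  have hgauge : ∀ z, Tendsto (fun j => gauge (closedPolytope (I j)) z) atTop (𝓝 (gauge K z)) := by
    intro z
    have h1 : Tendsto (fun j : ℕ => (1 + 1 / ((j : ℝ) + 1))⁻¹ * gauge K z) atTop
        (𝓝 (gauge K z)) := by
      simpa using (hlim.inv₀ one_ne_zero).mul_const (gauge K z)
    refine tendsto_of_tendsto_of_tendsto_of_le_of_le h1 tendsto_const_nhds (fun j => ?_)
      fun j => gauge_le_gauge_of_subset hK (hKI j) z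
    have := gauge_le_gauge_of_subset (hP j) (hIK j) z
    rwa [gauge_smul_left_of_nonneg (hs j).le] at this
  have hR' : ∀ j, closedPolytope (I j) ⊆ closedBall 0 (2 * R) := fun j x hx => by
    obtain ⟨y, hy, rfl⟩ := hIK j hx
    have := mem_closedBall_zero_iff.1 (hR hy)
    simp only [mem_closedBall_zero_iff, norm_smul, Real.norm_of_nonneg (hs j).le]
    nlinarith [hε1 j, norm_nonneg y, hε j]
  have ht := ENNReal.Tendsto.const_mul (a := hausdorffRatio m)
    (tendsto_boundaryMeasure_univ hK hP hr0 (fun j => hr.trans (hKI j)) (by positivity) hR'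
    hgauge) (Or.inr (hausdorffRatio_ne_top m))
  simp only [← hausdorffMeasure_frontier_polytope (hI _) (hP _)] at ht
  have hfin := hK.isFiniteMeasure_boundaryMeasure
  have h1 : μH[(m : ℝ)] (frontier K) ≤ hausdorffRatio m * boundaryMeasure K univ :=
    ge_of_tendsto' ht fun j =>
      hK.hausdorffMeasure_frontier_mono (hP j) (hKI j) (Nat.cast_nonneg _)
  have hA : μH[(m : ℝ)] (frontier K) ≠ ∞ :=
    (h1.trans_lt (ENNReal.mul_lt_top (hausdorffRatio_ne_top m).lt_top (measure_lt_top _ _))).ne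
  refine le_antisymm h1 ?_
  have h2 : Tendsto (fun j : ℕ => (‖1 + 1 / ((j : ℝ) + 1)‖₊ : ℝ≥0∞) ^ (m : ℝ) *
      μH[(m : ℝ)] (frontier K)) atTop (𝓝 (μH[(m : ℝ)] (frontier K))) := by
    have h3 := (ENNReal.continuous_rpow_const (y := (m : ℝ))).tendsto _ |>.comp
      (ENNReal.tendsto_coe.2 hlim.nnnorm)
    simpa using ENNReal.Tendsto.mul_const h3 (Or.inr hA)
  refine le_of_tendsto_of_tendsto' ht h2 fun j => ?_
  rw [← hausdorffMeasure_frontier_smul (hs j).ne' (Nat.cast_nonneg _)]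
  exact (hP j).hausdorffMeasure_frontier_mono (hK.smul (hs j).ne') (hIK j) (Nat.cast_nonneg _)

theorem IsCenteredBody.boundaryMeasure_openPolytope {K : Set (Eu (m + 1))}
    (hK : IsCenteredBody K) {I : Finset (Eu (m + 1) × ℝ)} (hI : ∀ q ∈ I, 0 < q.2) :
    boundaryMeasure (K ∩ closedPolytope I) (openPolytope I) =
      boundaryMeasure K (openPolytope I) := by
  have hL := hK.inter_closedPolytope hI
  set L := K ∩ closedPolytope I with hLdef
  have hm := (isOpen_openPolytope I).measurableSet
  rw [hL.boundaryMeasure_apply hm, hK.boundaryMeasure_apply hm]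
  refine lintegral_congr_ae (ae_restrict_of_ae ?_)
  filter_upwards [hK.ae_differentiableAt_gauge, hL.ae_differentiableAt_gauge, ae_ne_zero]
    with x hx hx' hx0
  have hgK := hK.gauge_pos hx0
  have hgL := hL.gauge_pos hx0
  have key : radialPoint L x ∈ openPolytope I ∨ radialPoint K x ∈ openPolytope I →
      gauge L x = gauge K x := by
    rintro (h | h)
    · have h1 : radialPoint L x ∈ frontier L ∩ openPolytope I :=
        ⟨hL.inv_gauge_smul_mem_frontier hx0, h⟩
      rw [frontier_inter_closedPolytope_inter] at h1
      have h2 := hK.gauge_eq_one_iff.2 h1.1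
      rw [radialPoint, hK.gauge_smul (by positivity), inv_mul_eq_one₀ hgL.ne'] at h2
      exact h2
    · have h1 : radialPoint K x ∈ frontier K ∩ openPolytope I :=
        ⟨hK.inv_gauge_smul_mem_frontier hx0, h⟩
      rw [← frontier_inter_closedPolytope_inter] at h1
      have h2 := hL.gauge_eq_one_iff.2 h1.1
      rw [radialPoint, hL.gauge_smul (by positivity), inv_mul_eq_one₀ hgK.ne'] at h2
      exact h2.symm
  have hsub : gauge L x = gauge K x → radialPoint L x = radialPoint K x ∧
      surfaceDensity L x = surfaceDensity K x := fun h => by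
    have h1 : gradient (gauge K) x = gradient (gauge L) x :=
      hL.eq_gradient hx' (fun z => (hK.inner_gradient_le hx z).trans
        (gauge_le_gauge_of_subset hL inter_subset_left z))
        (by rw [hK.inner_gradient_self hx, h])
    exact ⟨by rw [radialPoint, radialPoint, h], by rw [surfaceDensity, surfaceDensity, h, h1]⟩
  by_cases hc : radialPoint L x ∈ openPolytope I ∨ radialPoint K x ∈ openPolytope I
  · obtain ⟨h1, h2⟩ := hsub (key hc)
    by_cases h' : radialPoint K x ∈ openPolytope I <;>
      simp only [indicator, mem_preimage, h1, h2, h', if_true, if_false]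
  · push Not at hc
    simp only [indicator, mem_preimage, hc.1, hc.2, if_false]

theorem IsCenteredBody.hausdorffMeasure_openPolytope {K : Set (Eu (m + 1))}
    (hK : IsCenteredBody K) {I : Finset (Eu (m + 1) × ℝ)} (hI : ∀ q ∈ I, ‖q.1‖ = 1 ∧ 0 < q.2) :
    μH[(m : ℝ)] (openPolytope I ∩ frontier K) =
      hausdorffRatio m * boundaryMeasure K (openPolytope I) := by
  have hI0 := fun q hq => (hI q hq).2
  have hL := hK.inter_closedPolytope hI0
  rw [← hK.boundaryMeasure_openPolytope hI0, inter_comm, ← frontier_inter_closedPolytope_inter]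
  set L := K ∩ closedPolytope I with hLdef
  have hfin := hL.isFiniteMeasure_boundaryMeasure
  have hQ := (isOpen_openPolytope I).measurableSet
  have hB : MeasurableSet (frontier L \ openPolytope I) :=
    isClosed_frontier.measurableSet.diff hQ
  have h1 := hL.hausdorffMeasure_restrict_flat hI inter_subset_right hB sdiff_subset
    fun x hx => exists_inner_eq_of_notMem (hL.frontier_subset hx.1).2 hx.2
  have h2 := measure_inter_add_sdiff (μ := μH[(m : ℝ)]) (frontier L) hQ
  have h3 := measure_inter_add_sdiff (μ := boundaryMeasure L) (frontier L) hQ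
  rw [h1, hL.hausdorffMeasure_frontier, ← hL.boundaryMeasure_inter_frontier univ, univ_inter,
    ← h3, mul_add, inter_comm _ (openPolytope I),
    hL.boundaryMeasure_inter_frontier (openPolytope I)] at h2
  rw [inter_comm]
  exact (ENNReal.add_left_inj (ENNReal.mul_ne_top (hausdorffRatio_ne_top m)
    (measure_ne_top _ _))).1 h2

theorem borel_eq_generateFrom_openPolytope :
    (borel (Eu n)) = MeasurableSpace.generateFrom
      {Q | ∃ I : Finset (Eu n × ℝ), (∀ q ∈ I, ‖q.1‖ = 1 ∧ 0 < q.2) ∧ Q = openPolytope I} := by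
  set C := {Q | ∃ I : Finset (Eu n × ℝ), (∀ q ∈ I, ‖q.1‖ = 1 ∧ 0 < q.2) ∧ Q = openPolytope I}
    with hC
  have hpos : ∀ u : Eu n, ‖u‖ = 1 → ∀ t : ℝ, 0 < t →
      MeasurableSet[MeasurableSpace.generateFrom C] {x | ⟪x, u⟫ < t} := fun u hu t ht =>
    MeasurableSpace.measurableSet_generateFrom ⟨{(u, t)}, by simpa using ⟨hu, ht⟩,
      by simp [openPolytope]⟩
  have hle : ∀ u : Eu n, ‖u‖ = 1 → ∀ t : ℝ, 0 ≤ t →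
      MeasurableSet[MeasurableSpace.generateFrom C] {x | ⟪x, u⟫ ≤ t} := fun u hu t ht => by
    have : {x : Eu n | ⟪x, u⟫ ≤ t} = ⋂ k : ℕ, {x | ⟪x, u⟫ < t + 1 / ((k : ℝ) + 1)} := by
      ext x
      simp only [mem_iInter, mem_ofPred_eq]
      refine ⟨fun h k => h.trans_lt (lt_add_of_pos_right _ (by positivity)), fun h => ?_⟩
      have ht := (tendsto_one_div_add_atTop_nhds_zero_nat (𝕜 := ℝ)).const_add t
      rw [add_zero] at ht
      exact ge_of_tendsto' ht fun k => (h k).le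
    rw [this]
    exact MeasurableSet.iInter fun k => hpos u hu _ (by positivity)
  have hall : ∀ u : Eu n, ‖u‖ = 1 → ∀ t : ℝ,
      MeasurableSet[MeasurableSpace.generateFrom C] {x | ⟪x, u⟫ < t} := fun u hu t => by
    rcases lt_or_ge 0 t with ht | ht
    · exact hpos u hu t ht
    · have : {x : Eu n | ⟪x, u⟫ < t} = {x | ⟪x, -u⟫ ≤ -t}ᶜ := by
        ext x
        simp [inner_neg_right]
      rw [this]
      exact (hle (-u) (by simpa using hu) (-t) (by linarith)).compl
  refine le_antisymm ?_ (MeasurableSpace.generateFrom_le ?_)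
  · have hc : ∀ i, @Measurable _ _ (MeasurableSpace.generateFrom C) _ fun x : Eu n => x i :=
      fun i => measurable_of_Iio (mδ := MeasurableSpace.generateFrom C) fun t => by
        have := hall (EuclideanSpace.single i 1) (by simp) t
        simp only [EuclideanSpace.inner_single_right, conj_trivial, one_mul] at this
        exact this
    have h2 : @Measurable _ _ (MeasurableSpace.generateFrom C) _ fun (x : Eu n) i => x i :=
      @measurable_pi_lambda _ _ _ (MeasurableSpace.generateFrom C) _ _ hc
    have h3 : @Measurable (Eu n) (Eu n) (MeasurableSpace.generateFrom C) _ id :=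
      (WithLp.measurable_toLp 2 _).comp h2
    rw [← BorelSpace.measurable_eq (α := Eu n)]
    exact fun s hs => h3 hs
  · rintro _ ⟨I, -, rfl⟩
    rw [← BorelSpace.measurable_eq (α := Eu n)]
    exact (isOpen_openPolytope I).measurableSet

theorem isPiSystem_openPolytope : IsPiSystem
    {Q | ∃ I : Finset (Eu n × ℝ), (∀ q ∈ I, ‖q.1‖ = 1 ∧ 0 < q.2) ∧ Q = openPolytope I} := by
  classical
  rintro _ ⟨I, hI, rfl⟩ _ ⟨J, hJ, rfl⟩ -
  refine ⟨I ∪ J, fun q hq => (Finset.mem_union.1 hq).elim (hI q) (hJ q), ?_⟩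
  ext x
  simp only [openPolytope, mem_inter_iff, mem_ofPred_eq, Finset.mem_union, or_imp, forall_and]

/-- The Hausdorff measure on the boundary of a centered body in terms of radial projection. -/
theorem IsCenteredBody.restrict_frontier_eq {K : Set (Eu (m + 1))} (hK : IsCenteredBody K) :
    (μH[(m : ℝ)]).restrict (frontier K) = hausdorffRatio m • boundaryMeasure K := by
  have hfin := hK.isFiniteMeasure_boundaryMeasure
  have huniv : (μH[(m : ℝ)]).restrict (frontier K) univ =
      (hausdorffRatio m • boundaryMeasure K) univ := by
    simpa using hK.hausdorffMeasure_frontier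
  have : IsFiniteMeasure ((μH[(m : ℝ)] : Measure (Eu (m + 1))).restrict (frontier K)) := ⟨by
    rw [huniv]
    exact ENNReal.mul_lt_top (hausdorffRatio_ne_top m).lt_top (measure_lt_top _ _)⟩
  refine ext_of_generate_finite _ (BorelSpace.measurable_eq.trans
    borel_eq_generateFrom_openPolytope) isPiSystem_openPolytope ?_ huniv
  rintro _ ⟨I, hI, rfl⟩
  rw [Measure.restrict_apply (isOpen_openPolytope I).measurableSet,
    hK.hausdorffMeasure_openPolytope hI]
  rfl

end SurfaceArea

section LpSurface

variable {m n : ℕ} {K : Set (Eu n)} {o : Eu n}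

/-- The translate of `K` moving `o` to the origin. -/
def recenter (K : Set (Eu n)) (o : Eu n) : Set (Eu n) := (fun x => x + o) ⁻¹' K

theorem recenter_eq_image (K : Set (Eu n)) (o : Eu n) : recenter K o = (fun x => x - o) '' K := by
  ext x
  simp [recenter, sub_eq_iff_eq_add]

theorem isCenteredBody_recenter (hc : Convex ℝ K) (hK : IsCompact K) (ho : o ∈ interior K) :
    IsCenteredBody (recenter K o) where
  convex := hc.translate_preimage_left o
  isCompact := by
    rw [recenter_eq_image]
    exact hK.image (by fun_prop)
  mem_nhds := by
    have hc : Continuous fun x : Eu n => x + o := by fun_prop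
    exact hc.continuousAt.preimage_mem_nhds (by simpa using mem_interior_iff_mem_nhds.1 ho)

theorem frontier_recenter (K : Set (Eu n)) (o : Eu n) :
    frontier (recenter K o) = (fun x => x + o) ⁻¹' frontier K :=
  ((Homeomorph.addRight o).preimage_frontier K).symm

theorem isOuterNormal_recenter {y u : Eu n} :
    IsOuterNormal (recenter K o) y u ↔ IsOuterNormal K (y + o) u := by
  refine and_congr_right fun _ => ⟨fun h z hz => ?_, fun h z hz => ?_⟩
  · have := h (z - o) (by simpa [recenter] using hz)
    rw [inner_sub_left] at this
    rw [inner_add_left]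
    linarith
  · have := h (z + o) hz
    rw [inner_add_left, inner_add_left] at this
    linarith

theorem suppFn_recenter (hK : IsCompact K) (hne : K.Nonempty) (u : Eu n) :
    suppFn (recenter K o) u = suppFn K u - ⟪o, u⟫ := by
  have hK' : IsCompact (recenter K o) := by
    rw [recenter_eq_image]
    exact hK.image (by fun_prop)
  have hne' : (recenter K o).Nonempty := by
    rw [recenter_eq_image]
    exact hne.image _
  refine le_antisymm (suppFn_le hne' fun x hx => ?_) ?_
  · have := inner_le_suppFn hK hx u
    rw [inner_add_left] at this
    linarith
  · rw [sub_le_iff_le_add]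
    refine suppFn_le hne fun x hx => ?_
    have := inner_le_suppFn hK' (x := x - o) (by simpa [recenter] using hx) u
    rw [inner_sub_left] at this
    linarith

/-- The classical surface area measure on the sphere, up to normalization. -/
def sphereMeasure (K : Set (Eu n)) : Measure (Eu n) := (surfaceMeasure K).map (radialNormal K)

namespace IsCenteredBody

theorem isFiniteMeasure_sphereMeasure (hK : IsCenteredBody K) :
    IsFiniteMeasure (sphereMeasure K) := by
  have := hK.isFiniteMeasure_surfaceMeasure
  exact Measure.isFiniteMeasure_map _ _

theorem differentiableAt_gauge_smul (hK : IsCenteredBody K) {x : Eu n} {s : ℝ} (hs : 0 < s)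
    (hx : DifferentiableAt ℝ (gauge K) x) : DifferentiableAt ℝ (gauge K) (s • x) := by
  have h1 : gauge K = fun y => s * gauge K (s⁻¹ • y) := by
    funext y
    rw [hK.gauge_smul (by positivity), mul_inv_cancel_left₀ hs.ne']
  have h2 : DifferentiableAt ℝ (gauge K) (s⁻¹ • s • x) := by rwa [inv_smul_smul₀ hs.ne']
  have h3 : DifferentiableAt ℝ (fun y => gauge K (s⁻¹ • y)) (s • x) :=
    DifferentiableAt.comp (g := gauge K) (f := fun y => s⁻¹ • y) (s • x) h2 (by fun_prop)
  have h4 := h3.const_mul s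
  rwa [← h1] at h4

theorem radialNormal_smul (hK : IsCenteredBody K) {x : Eu n} {s : ℝ} (hs : 0 < s)
    (hx : DifferentiableAt ℝ (gauge K) x) : radialNormal K (s • x) = radialNormal K x := by
  have : gradient (gauge K) x = gradient (gauge K) (s • x) := by
    refine hK.eq_gradient (hK.differentiableAt_gauge_smul hs hx) (hK.inner_gradient_le hx) ?_
    rw [real_inner_smul_left, hK.inner_gradient_self hx, hK.gauge_smul hs.le]
  rw [radialNormal, radialNormal, this]

theorem ae_surfaceMeasure {K : Set (Eu (m + 1))} (hK : IsCenteredBody K) :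
    ∀ᵐ x ∂surfaceMeasure K, x ≠ 0 ∧ DifferentiableAt ℝ (gauge K) x := by
  refine (withDensity_absolutelyContinuous _ _).ae_le (ae_restrict_of_ae ?_)
  filter_upwards [ae_ne_zero, hK.ae_differentiableAt_gauge] with x h1 h2 using ⟨h1, h2⟩

theorem ae_differentiableAt_boundary {K : Set (Eu (m + 1))} (hK : IsCenteredBody K) :
    ∀ᵐ y ∂(μH[(m : ℝ)]).restrict (frontier K), DifferentiableAt ℝ (gauge K) y := by
  rw [hK.restrict_frontier_eq]
  refine Measure.ae_smul_measure ((ae_map_iff hK.measurable_radialPoint.aemeasurable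
    (measurableSet_of_differentiableAt ℝ _)).2 ?_) _
  filter_upwards [hK.ae_surfaceMeasure] with x hx
  exact hK.differentiableAt_gauge_smul (inv_pos.2 (hK.gauge_pos hx.1)) hx.2

theorem map_radialNormal_boundaryMeasure {K : Set (Eu (m + 1))} (hK : IsCenteredBody K) :
    (boundaryMeasure K).map (radialNormal K) = sphereMeasure K := by
  rw [boundaryMeasure, Measure.map_map (measurable_radialNormal K) hK.measurable_radialPoint]
  refine Measure.map_congr ?_
  filter_upwards [hK.ae_surfaceMeasure] with x hx
  exact hK.radialNormal_smul (inv_pos.2 (hK.gauge_pos hx.1)) hx.2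

theorem gaussMap_eq {K : Set (Eu n)} (hK : IsCenteredBody (recenter K o)) {y : Eu n}
    (hy : y ∈ frontier (recenter K o)) (hd : DifferentiableAt ℝ (gauge (recenter K o)) y) :
    gaussMap K (y + o) = radialNormal (recenter K o) y ∧ IsOuterNormal K (y + o)
      (radialNormal (recenter K o) y) := by
  have hg := hK.gauge_eq_one_iff.2 hy
  have hy0 : y ≠ 0 := by
    rintro rfl
    simp at hg
  have hr : radialPoint (recenter K o) y = y := by rw [radialPoint, hg, inv_one, one_smul]
  have h1 := hK.isOuterNormal_radialNormal hy0 hd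
  rw [hr, isOuterNormal_recenter] at h1
  refine ⟨?_, h1⟩
  have hex : ∃ u, IsOuterNormal K (y + o) u := ⟨_, h1⟩
  rw [gaussMap, dif_pos hex]
  refine hK.eq_radialNormal hy0 hd ?_
  rw [hr, isOuterNormal_recenter]
  exact hex.choose_spec

end IsCenteredBody

theorem lpSurf_eq_lintegral {K : Set (Eu (m + 1))} (hc : Convex ℝ K) (hK : IsCompact K)
    {o : Eu (m + 1)} (ho : o ∈ interior K) (p : ℝ) {ω : Set (Eu (m + 1))}
    (hω : MeasurableSet ω) :
    lpSurf p K ω = hausdorffRatio m *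
      ∫⁻ u in ω, ENNReal.ofReal (suppFn K u ^ (1 - p)) ∂sphereMeasure (recenter K o) := by
  have hL := isCenteredBody_recenter hc hK ho
  have hne : K.Nonempty := ⟨o, interior_subset ho⟩
  set L := recenter K o with hLdef
  have hd : (((m + 1 : ℕ) : ℝ) - 1) = m := by push_cast; ring
  have hfr : MeasurableSet (frontier L) := isClosed_frontier.measurableSet
  have hT : MeasurePreserving (fun y : Eu (m + 1) => y + o) μH[(m : ℝ)] μH[(m : ℝ)] :=
    (IsometryEquiv.addRight o).measurePreserving_hausdorffMeasure _
  have hTe : MeasurableEmbedding fun y : Eu (m + 1) => y + o :=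
    (MeasurableEquiv.addRight o).measurableEmbedding
  have hae : ∀ᵐ y ∂(μH[(m : ℝ)]).restrict (frontier L), gaussMap K (y + o) = radialNormal L y ∧
      ⟪y + o, gaussMap K (y + o)⟫ = suppFn K (radialNormal L y) := by
    filter_upwards [hL.ae_differentiableAt_boundary, ae_restrict_mem hfr] with y hy hyL
    obtain ⟨h1, h2⟩ := hL.gaussMap_eq hyL hy
    refine ⟨h1, ?_⟩
    rw [h1]
    refine (IsCenteredBody.suppFn_eq_of_isOuterNormal hK ?_ h2).symm
    have := hL.frontier_subset hyL
    exact this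
  have hset : (fun y => y + o) ⁻¹' {x ∈ frontier K | gaussMap K x ∈ ω} =ᵐ[μH[(m : ℝ)]]
      (radialNormal L ⁻¹' ω ∩ frontier L : Set _) := by
    rw [ae_restrict_iff' hfr] at hae
    filter_upwards [hae] with y hy
    refine propext ?_
    change (y + o ∈ frontier K ∧ gaussMap K (y + o) ∈ ω) ↔ (radialNormal L y ∈ ω ∧ y ∈ frontier L)
    have hf : y ∈ frontier L ↔ y + o ∈ frontier K := by rw [hLdef, frontier_recenter]; rfl
    rw [← hf, and_comm]
    exact and_congr_left fun h => by rw [(hy h).1]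
  have hmN := measurable_radialNormal L
  have hφ : Measurable fun u => ENNReal.ofReal (suppFn K u ^ (1 - p)) :=
    ((continuous_suppFn hK hne).measurable.pow_const _).ennreal_ofReal
  rw [lpSurf, hd, ← hT.setLIntegral_comp_preimage_emb hTe, setLIntegral_congr hset,
    ← Measure.restrict_restrict (hmN hω)]
  rw [lintegral_congr_ae (g := fun y => ENNReal.ofReal (suppFn K (radialNormal L y) ^ (1 - p)))
    (ae_restrict_of_ae (hae.mono fun y hy => by rw [hy.2])),
    hL.restrict_frontier_eq, Measure.restrict_smul, lintegral_smul_measure, smul_eq_mul,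
    ← hL.map_radialNormal_boundaryMeasure, setLIntegral_map hω hφ hmN]

end LpSurface

section Variation

variable {m n : ℕ} {K : Set (Eu n)} {f : Eu n → ℝ} {c t : ℝ}

/-- The Wulff shape of the support function of `K` perturbed by `t * f`. -/
def perturb (K : Set (Eu n)) (f : Eu n → ℝ) (t : ℝ) : Set (Eu n) :=
  {x | ∀ u, ‖u‖ = 1 → ⟪x, u⟫ ≤ suppFn K u + t * f u}

theorem isClosed_perturb (K : Set (Eu n)) (f : Eu n → ℝ) (t : ℝ) : IsClosed (perturb K f t) := by
  simp only [perturb, Set.ofPred_forall]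
  exact isClosed_iInter fun u => isClosed_iInter fun _ =>
    isClosed_le (by fun_prop) continuous_const

theorem convex_perturb (K : Set (Eu n)) (f : Eu n → ℝ) (t : ℝ) : Convex ℝ (perturb K f t) := by
  intro x hx y hy a b ha hb hab u hu
  rw [inner_add_left, real_inner_smul_left, real_inner_smul_left]
  have h1 := mul_le_mul_of_nonneg_left (hx u hu) ha
  have h2 := mul_le_mul_of_nonneg_left (hy u hu) hb
  have : suppFn K u + t * f u = a * (suppFn K u + t * f u) + b * (suppFn K u + t * f u) := by
    rw [← add_mul, hab, one_mul]
  linarith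

namespace IsCenteredBody

theorem gauge_le_of_forall_inner_le (hK : IsCenteredBody K) {x : Eu n} {s : ℝ} (hs : 0 ≤ s)
    (h : ∀ u, ‖u‖ = 1 → ⟪x, u⟫ ≤ s * suppFn K u) : gauge K x ≤ s := by
  rcases eq_or_ne x 0 with rfl | hx
  · simpa using hs
  have hg := hK.gauge_pos hx
  have hfr := hK.inv_gauge_smul_mem_frontier hx
  obtain ⟨u, hu, hmax⟩ := hK.exists_isOuterNormal hfr
  have hh := hK.suppFn_pos hu
  have h1 : suppFn K u ≤ (gauge K x)⁻¹ * ⟪x, u⟫ := by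
    rw [← real_inner_smul_left]
    exact suppFn_le hK.nonempty hmax
  have h2 := h u hu
  have h3 : gauge K x * suppFn K u ≤ ⟪x, u⟫ := by
    rwa [← div_eq_inv_mul, le_div_iff₀' hg] at h1
  exact le_of_mul_le_mul_right (h3.trans h2) hh

theorem inner_le_gauge_mul_suppFn (hK : IsCenteredBody K) (x u : Eu n) :
    ⟪x, u⟫ ≤ gauge K x * suppFn K u :=
  hK.inner_le_gauge_mul (fun _ hy => inner_le_suppFn hK.isCompact hy u) x

theorem perturb_zero (hK : IsCenteredBody K) : perturb K f 0 = K := by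
  ext x
  refine ⟨fun h => ?_, fun h u _ => ?_⟩
  · refine hK.gauge_le_one_iff.1 (hK.gauge_le_of_forall_inner_le zero_le_one fun u hu => ?_)
    simpa using h u hu
  · simpa using inner_le_suppFn hK.isCompact h u

theorem mem_perturb_of_gauge_le (hK : IsCenteredBody K)
    (hf : ∀ u, ‖u‖ = 1 → |f u| ≤ c * suppFn K u) (ht : 0 ≤ t) {x : Eu n}
    (hx : gauge K x ≤ 1 - t * c) : x ∈ perturb K f t := by
  intro u hu
  have h1 := hK.inner_le_gauge_mul_suppFn x u
  have h2 := mul_le_mul_of_nonneg_right hx (hK.suppFn_pos hu).le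
  have h3 := mul_le_mul_of_nonneg_left (abs_le.1 (hf u hu)).1 ht
  linarith

theorem gauge_le_of_mem_perturb (hK : IsCenteredBody K) (hc : 0 ≤ c)
    (hf : ∀ u, ‖u‖ = 1 → |f u| ≤ c * suppFn K u) (ht : 0 ≤ t) {x : Eu n}
    (hx : x ∈ perturb K f t) : gauge K x ≤ 1 + t * c := by
  refine hK.gauge_le_of_forall_inner_le (by positivity) fun u hu => ?_
  have h3 := mul_le_mul_of_nonneg_left (abs_le.1 (hf u hu)).2 ht
  linarith [hx u hu]

theorem isCenteredBody_perturb (hK : IsCenteredBody K) (hc : 0 ≤ c)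
    (hf : ∀ u, ‖u‖ = 1 → |f u| ≤ c * suppFn K u) (ht : 0 ≤ t) (htc : t * c < 1) :
    IsCenteredBody (perturb K f t) where
  convex := convex_perturb K f t
  isCompact := by
    have h : 0 < 1 + t * c := by positivity
    refine ((hK.smul h.ne').isCompact).of_isClosed_subset (isClosed_perturb K f t) fun x hx => ?_
    exact (hK.mem_smul_iff h).2 (hK.gauge_le_of_mem_perturb hc hf ht hx)
  mem_nhds := by
    have h : 0 < 1 - t * c := by linarith
    refine mem_of_superset (hK.smul h.ne').mem_nhds fun x hx => ?_
    exact hK.mem_perturb_of_gauge_le hf ht ((hK.mem_smul_iff h).1 hx)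

theorem gauge_le_mul_gauge_perturb (hK : IsCenteredBody K) (hc : 0 ≤ c)
    (hf : ∀ u, ‖u‖ = 1 → |f u| ≤ c * suppFn K u) (ht : 0 ≤ t) (htc : t * c < 1) {x : Eu n} :
    gauge K x ≤ (1 + t * c) * gauge (perturb K f t) x := by
  rcases eq_or_ne x 0 with rfl | hx
  · simp
  have hL := hK.isCenteredBody_perturb hc hf ht htc
  have hg := hL.gauge_pos hx
  have := hK.gauge_le_of_mem_perturb hc hf ht
    (hL.frontier_subset (hL.inv_gauge_smul_mem_frontier hx))
  rwa [hK.gauge_smul (by positivity), ← div_eq_inv_mul, div_le_iff₀ hg] at this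

theorem mul_gauge_perturb_le (hK : IsCenteredBody K) (hc : 0 ≤ c)
    (hf : ∀ u, ‖u‖ = 1 → |f u| ≤ c * suppFn K u) (ht : 0 ≤ t) (htc : t * c < 1) {x : Eu n} :
    (1 - t * c) * gauge (perturb K f t) x ≤ gauge K x := by
  rcases eq_or_ne x 0 with rfl | hx
  · simp
  have hL := hK.isCenteredBody_perturb hc hf ht htc
  have hg := hK.gauge_pos hx
  have h0 : 0 ≤ (1 - t * c) * (gauge K x)⁻¹ := mul_nonneg (by linarith) (by positivity)
  have h1 : ((1 - t * c) * (gauge K x)⁻¹) • x ∈ perturb K f t := by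
    refine hK.mem_perturb_of_gauge_le hf ht ?_
    rw [hK.gauge_smul h0, inv_mul_cancel_right₀ hg.ne']
  have := hL.gauge_le_one_iff.2 h1
  rwa [hL.gauge_smul h0, mul_right_comm, ← div_eq_mul_inv, div_le_one hg] at this

theorem exists_inner_eq_of_mem_frontier_perturb (hK : IsCenteredBody K) (hf : Continuous f)
    {y : Eu (n)} (hy : y ∈ frontier (perturb K f t)) (hy0 : y ≠ 0) :
    ∃ u, ‖u‖ = 1 ∧ ⟪y, u⟫ = suppFn K u + t * f u := by
  have hyL : y ∈ perturb K f t := (isClosed_perturb K f t).frontier_subset hy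
  have hne : (sphere (0 : Eu n) 1).Nonempty :=
    ⟨‖y‖⁻¹ • y, by simp [norm_smul, norm_ne_zero_iff.2 hy0]⟩
  have hcont : Continuous fun u => suppFn K u + t * f u - ⟪y, u⟫ :=
    ((continuous_suppFn hK.isCompact hK.nonempty).add (continuous_const.mul hf)).sub (by fun_prop)
  obtain ⟨u, hu, hmin⟩ := (isCompact_sphere (0 : Eu n) 1).exists_isMinOn hne hcont.continuousOn
  rw [mem_sphere_zero_iff_norm] at hu
  refine ⟨u, hu, le_antisymm (hyL u hu) ?_⟩
  by_contra! hlt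
  refine hy.2 (mem_interior.2 ⟨ball y (suppFn K u + t * f u - ⟪y, u⟫), fun z hz w hw => ?_,
    isOpen_ball, mem_ball_self (by linarith)⟩)
  have h1 := hmin (mem_sphere_zero_iff_norm.2 hw)
  simp only [mem_ofPred_eq] at h1
  rw [mem_ball_iff_norm] at hz
  have h2 := real_inner_le_norm (z - y) w
  rw [hw, mul_one, inner_sub_left] at h2
  linarith

theorem tendsto_gauge_perturb (hK : IsCenteredBody K) (hc : 0 ≤ c)
    (hf : ∀ u, ‖u‖ = 1 → |f u| ≤ c * suppFn K u) {x : Eu n} (hx0 : x ≠ 0) :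
    Tendsto (fun t => (gauge (perturb K f t) x)⁻¹) (𝓝[>] 0) (𝓝 (gauge K x)⁻¹) := by
  have hg := hK.gauge_pos hx0
  have hsm : ∀ᶠ t : ℝ in 𝓝[>] 0, t * c < 1 :=
    (((continuous_id.mul continuous_const).tendsto' (0 : ℝ) 0 (by simp)).eventually_lt_const
      one_pos).filter_mono nhdsWithin_le_nhds
  have h1 : Tendsto (fun t : ℝ => (1 - t * c) * (gauge K x)⁻¹) (𝓝[>] 0) (𝓝 (gauge K x)⁻¹) :=
    (Continuous.tendsto' (by fun_prop) _ _ (by simp)).mono_left nhdsWithin_le_nhds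
  have h2 : Tendsto (fun t : ℝ => (1 + t * c) * (gauge K x)⁻¹) (𝓝[>] 0) (𝓝 (gauge K x)⁻¹) :=
    (Continuous.tendsto' (by fun_prop) _ _ (by simp)).mono_left nhdsWithin_le_nhds
  refine tendsto_of_tendsto_of_tendsto_of_le_of_le' h1 h2 ?_ ?_
  · filter_upwards [hsm, self_mem_nhdsWithin] with t ht ht0
    have hL := (hK.isCenteredBody_perturb hc hf (mem_Ioi.1 ht0).le ht).gauge_pos hx0
    rw [← div_eq_mul_inv, div_le_iff₀ hg, ← div_eq_inv_mul, le_div_iff₀ hL]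
    exact hK.mul_gauge_perturb_le hc hf (mem_Ioi.1 ht0).le ht
  · filter_upwards [hsm, self_mem_nhdsWithin] with t ht ht0
    have hL := (hK.isCenteredBody_perturb hc hf (mem_Ioi.1 ht0).le ht).gauge_pos hx0
    rw [← div_eq_mul_inv, le_div_iff₀ hg, ← div_eq_inv_mul, div_le_iff₀ hL]
    exact hK.gauge_le_mul_gauge_perturb hc hf (mem_Ioi.1 ht0).le ht

theorem tendsto_slope_gauge_perturb (hK : IsCenteredBody K) (hc : 0 ≤ c) (hfc : Continuous f)
    (hf : ∀ u, ‖u‖ = 1 → |f u| ≤ c * suppFn K u) {x : Eu n} (hx0 : x ≠ 0)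
    (hx : DifferentiableAt ℝ (gauge K) x) :
    Tendsto (fun t => ((gauge (perturb K f t) x)⁻¹ - (gauge K x)⁻¹) / t) (𝓝[>] 0)
      (𝓝 (f (radialNormal K x) / ⟪x, radialNormal K x⟫)) := by
  have hg := hK.gauge_pos hx0
  have hsm : ∀ᶠ t : ℝ in 𝓝[>] 0, t * c < 1 :=
    (((continuous_id.mul continuous_const).tendsto' (0 : ℝ) 0 (by simp)).eventually_lt_const
      one_pos).filter_mono nhdsWithin_le_nhds
  have hex : ∀ t : ℝ, ∃ u, 0 < t → t * c < 1 → ‖u‖ = 1 ∧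
      (gauge (perturb K f t) x)⁻¹ * ⟪x, u⟫ = suppFn K u + t * f u := by
    intro t
    by_cases ht : 0 < t ∧ t * c < 1
    · have hL := hK.isCenteredBody_perturb hc hf ht.1.le ht.2
      have hgL := hL.gauge_pos hx0
      obtain ⟨u, hu, h⟩ := hK.exists_inner_eq_of_mem_frontier_perturb hfc
        (hL.inv_gauge_smul_mem_frontier hx0) (smul_ne_zero (inv_ne_zero hgL.ne') hx0)
      rw [real_inner_smul_left] at h
      exact ⟨u, fun _ _ => ⟨hu, h⟩⟩
    · exact ⟨0, fun h1 h2 => absurd ⟨h1, h2⟩ ht⟩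
  choose u hu using hex
  set v : ℝ → Eu n := fun t => (suppFn K (u t))⁻¹ • u t with hv
  obtain ⟨r, hr0, hr⟩ := hK.exists_ball_subset
  have hs := hK.tendsto_gauge_perturb hc hf hx0
  have hev : ∀ᶠ t : ℝ in 𝓝[>] 0, 0 < t ∧ t * c < 1 := by
    filter_upwards [hsm, self_mem_nhdsWithin] with t ht ht0 using ⟨ht0, ht⟩
  have hvt : Tendsto v (𝓝[>] 0) (𝓝 (gradient (gauge K) x)) := by
    refine tendsto_gradient_gauge hK hx (C := r⁻¹) ?_ (φ := fun _ => gauge K)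
      (fun z => tendsto_const_nhds) ?_ ?_
    · filter_upwards [hev] with t ht
      have h1 := hK.le_suppFn hr (hu t ht.1 ht.2).1
      rw [hv, norm_smul, (hu t ht.1 ht.2).1, mul_one, Real.norm_of_nonneg
        (inv_nonneg.2 (hr0.le.trans h1))]
      exact inv_anti₀ hr0 h1
    · filter_upwards [hev] with t ht z
      have h1 := hK.suppFn_pos (hu t ht.1 ht.2).1
      rw [hv, real_inner_smul_right, ← div_eq_inv_mul, div_le_iff₀ h1]
      exact hK.inner_le_gauge_mul_suppFn z _
    · have h1 : Tendsto (fun t : ℝ => (1 - t * c) * ((gauge (perturb K f t) x)⁻¹)⁻¹) (𝓝[>] 0)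
          (𝓝 (gauge K x)) := by
        have h2 : Tendsto (fun t : ℝ => 1 - t * c) (𝓝[>] 0) (𝓝 1) :=
          (Continuous.tendsto' (by fun_prop) _ _ (by simp)).mono_left nhdsWithin_le_nhds
        simpa using h2.mul (hs.inv₀ (inv_ne_zero hg.ne'))
      refine tendsto_of_tendsto_of_tendsto_of_le_of_le' h1 tendsto_const_nhds ?_ ?_
      · filter_upwards [hev] with t ht
        obtain ⟨hu1, hu2⟩ := hu t ht.1 ht.2
        have hgL := (hK.isCenteredBody_perturb hc hf ht.1.le ht.2).gauge_pos hx0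
        have h1 := hK.suppFn_pos hu1
        have h3 := mul_le_mul_of_nonneg_left (abs_le.1 (hf _ hu1)).1 ht.1.le
        rw [inv_inv, real_inner_smul_right, ← div_eq_inv_mul, le_div_iff₀ h1]
        rw [inv_mul_eq_iff_eq_mul₀ hgL.ne'] at hu2
        rw [hu2]
        nlinarith
      · filter_upwards [hev] with t ht
        have h1 := hK.suppFn_pos (hu t ht.1 ht.2).1
        rw [real_inner_smul_right, ← div_eq_inv_mul, div_le_iff₀ h1]
        exact hK.inner_le_gauge_mul_suppFn x _
  have hgr := hK.gradient_ne_zero hx0 hx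
  have hut : Tendsto u (𝓝[>] 0) (𝓝 (radialNormal K x)) := by
    have h1 : Tendsto (fun t => ‖v t‖⁻¹ • v t) (𝓝[>] 0) (𝓝 (radialNormal K x)) :=
      (hvt.norm.inv₀ (norm_ne_zero_iff.2 hgr)).smul hvt
    refine h1.congr' ?_
    filter_upwards [hev] with t ht
    have h1 := hK.suppFn_pos (hu t ht.1 ht.2).1
    rw [hv]
    simp only [norm_smul, (hu t ht.1 ht.2).1, mul_one, norm_inv, inv_inv, smul_smul,
      Real.norm_of_nonneg h1.le]
    rw [mul_inv_cancel₀ h1.ne', one_smul]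
  have hν := hK.norm_radialNormal hx0 hx
  have hh := hK.suppFn_pos hν
  have hin : ⟪x, radialNormal K x⟫ = gauge K x * suppFn K (radialNormal K x) := by
    rw [hK.suppFn_radialNormal hx0 hx, radialNormal, real_inner_smul_right,
      hK.inner_gradient_self hx, mul_comm]
  have hin0 : 0 < ⟪x, radialNormal K x⟫ := by rw [hin]; positivity
  have hlow : Tendsto (fun t => f (u t) / ⟪x, u t⟫) (𝓝[>] 0)
      (𝓝 (f (radialNormal K x) / ⟪x, radialNormal K x⟫)) :=
    ((hfc.tendsto _).comp hut).div
      (((by fun_prop : Continuous fun w : Eu n => ⟪x, w⟫).tendsto _).comp hut) hin0.ne'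
  refine tendsto_of_tendsto_of_tendsto_of_le_of_le' hlow tendsto_const_nhds ?_ ?_
  · filter_upwards [hev] with t ht
    obtain ⟨hu1, hu2⟩ := hu t ht.1 ht.2
    have hgL := (hK.isCenteredBody_perturb hc hf ht.1.le ht.2).gauge_pos hx0
    have h1 := hK.suppFn_pos hu1
    have h3 := mul_le_mul_of_nonneg_left (abs_le.1 (hf _ hu1)).1 ht.1.le
    have h4 : 0 < ⟪x, u t⟫ := by
      rw [inv_mul_eq_iff_eq_mul₀ hgL.ne'] at hu2
      rw [hu2]
      refine mul_pos hgL ?_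
      nlinarith [ht.2]
    have h5 : (gauge K x)⁻¹ * ⟪x, u t⟫ ≤ suppFn K (u t) := by
      rw [← div_eq_inv_mul, div_le_iff₀' hg]
      exact hK.inner_le_gauge_mul_suppFn x _
    rw [div_le_div_iff₀ h4 ht.1]
    linarith
  · filter_upwards [hev] with t ht
    have hL := hK.isCenteredBody_perturb hc hf ht.1.le ht.2
    have h1 := hL.frontier_subset (hL.inv_gauge_smul_mem_frontier hx0) _ hν
    rw [real_inner_smul_left] at h1
    rw [div_le_div_iff₀ ht.1 hin0, sub_mul, hin, inv_mul_cancel_left₀ hg.ne', ← hin]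
    linarith

end IsCenteredBody

end Variation

section VolumeVariation

variable {m : ℕ} {K : Set (Eu (m + 1))} {f : Eu (m + 1) → ℝ} {c : ℝ}

namespace IsCenteredBody

theorem volume_eq_lintegral (hK : IsCenteredBody K) :
    volume K = ∫⁻ x in ball 0 1, ENNReal.ofReal ((‖x‖ / gauge K x) ^ (m + 1)) := by
  have hm : Measurable fun x : Eu (m + 1) => ‖x‖ / gauge K x :=
    measurable_norm.div hK.continuous_gauge.measurable
  rw [← volume_norm_lt_homogeneous hm (fun x => div_nonneg (norm_nonneg _) (gauge_nonneg _))]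
  · refine measure_congr ?_
    have hfr : ∀ᵐ x : Eu (m + 1), x ∉ frontier K :=
      measure_eq_zero_iff_ae_notMem.1 (hK.convex.addHaar_frontier volume)
    filter_upwards [ae_ne_zero, hfr] with x hx0 hx
    have hg := hK.gauge_pos hx0
    have hn := norm_pos_iff.2 hx0
    refine propext ?_
    change x ∈ K ↔ ‖x‖ < ‖x‖ / gauge K x
    rw [lt_div_iff₀ hg, mul_lt_iff_lt_one_right hn, ← hK.gauge_le_one_iff]
    exact ⟨fun h => h.lt_of_ne fun h1 => hx (hK.gauge_eq_one_iff.1 h1), le_of_lt⟩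
  · intro s hs x
    rw [norm_smul, hK.gauge_smul hs.le, Real.norm_of_nonneg hs.le, mul_div_mul_left _ _ hs.ne']

theorem integrable_norm_div_gauge_pow (hK : IsCenteredBody K) :
    IntegrableOn (fun x => (‖x‖ / gauge K x) ^ (m + 1)) (ball 0 1) := by
  obtain ⟨R, hR0, hR⟩ := hK.exists_subset_closedBall
  have hm : Measurable fun x : Eu (m + 1) => (‖x‖ / gauge K x) ^ (m + 1) :=
    (measurable_norm.div hK.continuous_gauge.measurable).pow_const _
  refine Measure.integrableOn_of_bounded (M := R ^ (m + 1)) measure_ball_lt_top.ne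
    hm.aestronglyMeasurable (Eventually.of_forall fun x => ?_)
  have h0 : 0 ≤ ‖x‖ / gauge K x := div_nonneg (norm_nonneg _) (gauge_nonneg _)
  rw [Real.norm_of_nonneg (by positivity)]
  exact pow_le_pow_left₀ h0 (hK.norm_div_gauge_le hR0 hR x) _

theorem volume_real_eq_integral (hK : IsCenteredBody K) :
    volume.real K = ∫ x in ball 0 1, (‖x‖ / gauge K x) ^ (m + 1) := by
  rw [integral_eq_lintegral_of_nonneg_ae (Eventually.of_forall fun x => ?_)
    hK.integrable_norm_div_gauge_pow.aestronglyMeasurable, measureReal_def,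
    hK.volume_eq_lintegral]
  exact pow_nonneg (div_nonneg (norm_nonneg _) (gauge_nonneg _)) _

theorem tendsto_slope_norm_div_gauge_perturb_pow (hK : IsCenteredBody K) (hc : 0 ≤ c)
    (hfc : Continuous f) (hf : ∀ u, ‖u‖ = 1 → |f u| ≤ c * suppFn K u) {x : Eu (m + 1)}
    (hx0 : x ≠ 0) (hx : DifferentiableAt ℝ (gauge K) x) :
    Tendsto (fun t => ((‖x‖ / gauge (perturb K f t) x) ^ (m + 1) -
      (‖x‖ / gauge K x) ^ (m + 1)) / t) (𝓝[>] 0)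
      (𝓝 (surfaceDensity K x * f (radialNormal K x))) := by
  have hg := hK.gauge_pos hx0
  set F : ℝ → ℝ := fun t => ‖x‖ / gauge (perturb K f t) x with hF
  have hF0 : F 0 = ‖x‖ / gauge K x := by rw [hF]; simp only [hK.perturb_zero]
  have h1 := (hK.tendsto_slope_gauge_perturb hc hfc hf hx0 hx).const_mul ‖x‖
  have hd : HasDerivWithinAt F (‖x‖ * (f (radialNormal K x) / ⟪x, radialNormal K x⟫))
      (Ioi 0) 0 := by
    rw [hasDerivWithinAt_iff_tendsto_slope' (by simp)]
    refine h1.congr fun t => ?_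
    rw [slope_def_field, hF0, hF]
    ring
  have hd2 := hd.fun_pow (m + 1)
  rw [hasDerivWithinAt_iff_tendsto_slope' (by simp)] at hd2
  have hin : ⟪x, radialNormal K x⟫ = ‖gradient (gauge K) x‖⁻¹ * gauge K x := by
    rw [radialNormal, real_inner_smul_right, hK.inner_gradient_self hx]
  have hgr := norm_ne_zero_iff.2 (hK.gradient_ne_zero hx0 hx)
  convert hd2 using 2
  · rw [slope_def_field, hF0, sub_zero]
  · rw [hF0, hin, surfaceDensity]
    rw [Nat.add_sub_cancel, pow_succ]
    field_simp

theorem integral_sphereMeasure (hK : IsCenteredBody K) (hfc : Continuous f) :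
    ∫ u, f u ∂sphereMeasure K =
      ∫ x in ball 0 1, surfaceDensity K x * f (radialNormal K x) := by
  rw [sphereMeasure, integral_map (measurable_radialNormal K).aemeasurable
    hfc.aestronglyMeasurable, surfaceMeasure, integral_withDensity_eq_integral_toReal_smul
    hK.measurable_surfaceDensity.ennreal_ofReal (Eventually.of_forall fun _ => by simp)]
  simp_rw [ENNReal.toReal_ofReal (surfaceDensity_nonneg K _), smul_eq_mul]

theorem tendsto_slope_volume_perturb (hK : IsCenteredBody K) (hc : 0 ≤ c)
    (hfc : Continuous f) (hf : ∀ u, ‖u‖ = 1 → |f u| ≤ c * suppFn K u) :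
    Tendsto (fun t => (volume.real (perturb K f t) - volume.real K) / t) (𝓝[>] 0)
      (𝓝 (∫ u, f u ∂sphereMeasure K)) := by
  obtain ⟨R, hR0, hR⟩ := hK.exists_subset_closedBall
  have hsm : ∀ᶠ t : ℝ in 𝓝[>] 0, t * c < 1 :=
    (((continuous_id.mul continuous_const).tendsto' (0 : ℝ) 0 (by simp)).eventually_lt_const
      one_pos).filter_mono nhdsWithin_le_nhds
  have hev : ∀ᶠ t : ℝ in 𝓝[>] 0, 0 < t ∧ t * c < 1 := by
    filter_upwards [hsm, self_mem_nhdsWithin] with t ht ht0 using ⟨ht0, ht⟩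
  rw [hK.integral_sphereMeasure hfc]
  have key : Tendsto (fun t => ∫ x in ball (0 : Eu (m + 1)) 1,
      ((‖x‖ / gauge (perturb K f t) x) ^ (m + 1) - (‖x‖ / gauge K x) ^ (m + 1)) / t) (𝓝[>] 0)
      (𝓝 (∫ x in ball 0 1, surfaceDensity K x * f (radialNormal K x))) := by
    refine tendsto_integral_filter_of_dominated_convergence
      (fun _ => c * R * (m + 1 : ℕ) * (2 * R) ^ m) ?_ ?_ ?_ ?_
    · filter_upwards [hev] with t ht
      have hL := hK.isCenteredBody_perturb hc hf ht.1.le ht.2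
      exact ((hL.integrable_norm_div_gauge_pow.sub
        hK.integrable_norm_div_gauge_pow).div_const t).aestronglyMeasurable
    · filter_upwards [hev] with t ht
      refine ae_restrict_of_ae ?_
      filter_upwards [ae_ne_zero] with x hx0
      have hL := hK.isCenteredBody_perturb hc hf ht.1.le ht.2
      have hgL := hL.gauge_pos hx0
      have hg := hK.gauge_pos hx0
      have hn := norm_pos_iff.2 hx0
      have hb := hK.norm_div_gauge_le hR0 hR x
      have h1 : ‖x‖ / gauge (perturb K f t) x ≤ (1 + t * c) * (‖x‖ / gauge K x) := by
        rw [mul_div_assoc', div_le_div_iff₀ hgL hg]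
        have := hK.gauge_le_mul_gauge_perturb hc hf ht.1.le ht.2 (x := x)
        nlinarith
      have h2 : (1 - t * c) * (‖x‖ / gauge K x) ≤ ‖x‖ / gauge (perturb K f t) x := by
        rw [mul_div_assoc', div_le_div_iff₀ hg hgL]
        have := hK.mul_gauge_perturb_le hc hf ht.1.le ht.2 (x := x)
        nlinarith
      have ha0 : 0 < ‖x‖ / gauge (perturb K f t) x := by positivity
      have hb0 : 0 < ‖x‖ / gauge K x := by positivity
      set a := ‖x‖ / gauge (perturb K f t) x
      set b := ‖x‖ / gauge K x
      have htc : 0 ≤ t * c := mul_nonneg ht.1.le hc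
      have h3 : |a - b| ≤ t * (c * R) := by
        have : t * c * b ≤ t * c * R := mul_le_mul_of_nonneg_left hb htc
        rw [abs_le]
        constructor <;> nlinarith
      have h4 : max |a| |b| ≤ 2 * R := by
        rw [abs_of_pos ha0, abs_of_pos hb0]
        refine max_le ?_ (by linarith)
        nlinarith [ht.2]
      have h5 := abs_pow_sub_pow_le a b (m + 1)
      rw [Nat.add_sub_cancel] at h5
      rw [Real.norm_eq_abs, abs_div, abs_of_pos ht.1, div_le_iff₀ ht.1]
      calc |a ^ (m + 1) - b ^ (m + 1)| ≤ |a - b| * (m + 1 : ℕ) * max |a| |b| ^ m := h5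
        _ ≤ t * (c * R) * (m + 1 : ℕ) * (2 * R) ^ m := by
          have : 0 ≤ t * (c * R) * (m + 1 : ℕ) :=
            mul_nonneg (mul_nonneg ht.1.le (mul_nonneg hc hR0.le)) (Nat.cast_nonneg _)
          gcongr
        _ = c * R * (m + 1 : ℕ) * (2 * R) ^ m * t := by ring
    · exact integrable_const_iff.2 (Or.inr ⟨by simpa using measure_ball_lt_top⟩)
    · refine ae_restrict_of_ae ?_
      filter_upwards [ae_ne_zero, hK.ae_differentiableAt_gauge] with x hx0 hx
      exact hK.tendsto_slope_norm_div_gauge_perturb_pow hc hfc hf hx0 hx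
  refine key.congr' ?_
  filter_upwards [hev] with t ht
  have hL := hK.isCenteredBody_perturb hc hf ht.1.le ht.2
  rw [hL.volume_real_eq_integral, hK.volume_real_eq_integral, integral_div,
    integral_sub hL.integrable_norm_div_gauge_pow hK.integrable_norm_div_gauge_pow]

end IsCenteredBody

end VolumeVariation

section Energy

variable {n : ℕ} {K L : Set (Eu n)} {p : ℝ} {μ : Measure (Eu n)} {ξ η : Eu n}

theorem integrable_of_continuous_of_ae_norm_eq_one [IsFiniteMeasure μ] (hμ : ∀ᵐ u ∂μ, ‖u‖ = 1)
    {f : Eu n → ℝ} (hf : Continuous f) : Integrable f μ := by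
  obtain ⟨C, hC⟩ := (isCompact_sphere (0 : Eu n) 1).exists_bound_of_continuousOn hf.continuousOn
  refine Integrable.of_bound hf.aestronglyMeasurable C ?_
  filter_upwards [hμ] with u hu using hC u (by simpa using hu)

theorem suppFn_smul_set (hK : IsCompact K) (hne : K.Nonempty) {s : ℝ} (hs : 0 ≤ s) (u : Eu n) :
    suppFn (s • K) u = s * suppFn K u := by
  rw [← suppFn_smul hK hne hs]
  refine le_antisymm (suppFn_le hne.smul_set ?_) (suppFn_le hne fun x hx => ?_)
  · rintro _ ⟨x, hx, rfl⟩
    simpa [real_inner_smul_left, real_inner_smul_right] using inner_le_suppFn hK hx (s • u)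
  · simpa [real_inner_smul_left, real_inner_smul_right] using
      inner_le_suppFn (hK.smul s) (smul_mem_smul_set hx) u

theorem suppFn_sub_inner_nonneg (hK : IsCompact K) (hξ : ξ ∈ K) (u : Eu n) :
    0 ≤ suppFn K u - ⟪ξ, u⟫ := sub_nonneg.2 (inner_le_suppFn hK hξ u)

/-- The `L_p` energy of `K` relative to the point `ξ`. -/
def energy (p : ℝ) (μ : Measure (Eu n)) (K : Set (Eu n)) (ξ : Eu n) : ℝ :=
  ∫ u, (suppFn K u - ⟪ξ, u⟫) ^ p ∂μ

/-- The maximum over `ξ ∈ K` of the energy of `K` relative to `ξ`. -/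
def maxEnergy (p : ℝ) (μ : Measure (Eu n)) (K : Set (Eu n)) : ℝ := sSup (energy p μ K '' K)

theorem integrable_energy [IsFiniteMeasure μ] (hμ : ∀ᵐ u ∂μ, ‖u‖ = 1) (hp0 : 0 < p)
    (hK : IsCompact K) (hne : K.Nonempty) (ξ : Eu n) :
    Integrable (fun u => (suppFn K u - ⟪ξ, u⟫) ^ p) μ :=
  integrable_of_continuous_of_ae_norm_eq_one hμ
    (((continuous_suppFn hK hne).sub (by fun_prop)).rpow_const fun _ => Or.inr hp0.le)

theorem energy_smul (hK : IsCompact K) (hξ : ξ ∈ K) {s : ℝ} (hs : 0 ≤ s) :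
    energy p μ (s • K) (s • ξ) = s ^ p * energy p μ K ξ := by
  rw [energy, energy, ← integral_const_mul]
  refine integral_congr_ae (Eventually.of_forall fun u => ?_)
  simp only
  rw [suppFn_smul_set hK ⟨ξ, hξ⟩ hs, real_inner_smul_left, ← mul_sub,
    Real.mul_rpow hs (suppFn_sub_inner_nonneg hK hξ u)]

theorem energy_recenter (hK : IsCompact K) (hne : K.Nonempty) (o : Eu n) :
    energy p μ (recenter K o) (ξ - o) = energy p μ K ξ := by
  simp only [energy, suppFn_recenter hK hne, inner_sub_left]
  congr 1
  ext u
  congr 1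
  ring

theorem energy_le_add [IsFiniteMeasure μ] (hμ : ∀ᵐ u ∂μ, ‖u‖ = 1) (hp0 : 0 < p) (hp1 : p < 1)
    (hK : IsCompact K) (hL : IsCompact L) (hξ : ξ ∈ K) (hη : η ∈ L) {δ : ℝ} (hδ : 0 ≤ δ)
    (h : ∀ u, ‖u‖ = 1 → suppFn K u - ⟪ξ, u⟫ ≤ suppFn L u - ⟪η, u⟫ + δ) :
    energy p μ K ξ ≤ energy p μ L η + μ.real univ * δ ^ p := by
  have h1 := integrable_energy hμ hp0 hL ⟨η, hη⟩ η
  have h2 : energy p μ L η + μ.real univ * δ ^ p =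
      ∫ u, ((suppFn L u - ⟪η, u⟫) ^ p + δ ^ p) ∂μ := by
    rw [integral_add h1 (integrable_const _), integral_const, smul_eq_mul, energy]
  rw [h2]
  refine integral_mono_ae (integrable_energy hμ hp0 hK ⟨ξ, hξ⟩ ξ)
    (h1.add (integrable_const _)) ?_
  filter_upwards [hμ] with u hu
  exact (Real.rpow_le_rpow (suppFn_sub_inner_nonneg hK hξ u) (h u hu) hp0.le).trans
    (Real.rpow_add_le_add_rpow (suppFn_sub_inner_nonneg hL hη u) hδ hp0.le hp1.le)

theorem energy_le_add_of_near [IsFiniteMeasure μ] (hμ : ∀ᵐ u ∂μ, ‖u‖ = 1) (hp0 : 0 < p)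
    (hp1 : p < 1) (hK : IsCompact K) (hL : IsCompact L) (hξ : ξ ∈ K) (hη : η ∈ L) {δ : ℝ}
    (hδ : ‖ξ - η‖ ≤ δ) (h : ∀ x ∈ K, ∃ y ∈ L, ‖x - y‖ ≤ δ) :
    energy p μ K ξ ≤ energy p μ L η + μ.real univ * (2 * δ) ^ p := by
  have hδ0 : 0 ≤ δ := (norm_nonneg _).trans hδ
  refine energy_le_add hμ hp0 hp1 hK hL hξ hη (by positivity) fun u hu => ?_
  have h1 : suppFn K u ≤ suppFn L u + δ := by
    refine suppFn_le ⟨ξ, hξ⟩ fun x hx => ?_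
    obtain ⟨y, hy, hxy⟩ := h x hx
    have h2 := inner_le_suppFn hL hy u
    have h3 := real_inner_le_norm (x - y) u
    rw [hu, mul_one, inner_sub_left] at h3
    linarith
  have h3 := real_inner_le_norm (η - ξ) u
  rw [hu, mul_one, inner_sub_left, norm_sub_rev] at h3
  linarith

theorem tendsto_const_mul_two_mul_rpow (hp0 : 0 < p) (C : ℝ) :
    Tendsto (fun δ : ℝ => C * (2 * δ) ^ p) (𝓝 0) (𝓝 0) := by
  have h : Continuous fun δ : ℝ => C * (2 * δ) ^ p :=
    continuous_const.mul ((continuous_const.mul continuous_id).rpow_const fun _ => Or.inr hp0.le)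
  exact h.tendsto' _ _ (by simp [Real.zero_rpow hp0.ne'])

theorem continuousOn_energy [IsFiniteMeasure μ] (hμ : ∀ᵐ u ∂μ, ‖u‖ = 1) (hp0 : 0 < p)
    (hp1 : p < 1) (hK : IsCompact K) : ContinuousOn (energy p μ K) K := by
  intro ξ hξ
  rw [ContinuousWithinAt, tendsto_iff_dist_tendsto_zero]
  have h1 : Tendsto (fun η => ‖η - ξ‖) (𝓝[K] ξ) (𝓝 0) :=
    (Continuous.tendsto' (by fun_prop) _ _ (by simp)).mono_left nhdsWithin_le_nhds
  refine squeeze_zero' (Eventually.of_forall fun _ => dist_nonneg) ?_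
    ((tendsto_const_mul_two_mul_rpow hp0 (μ.real univ)).comp h1)
  filter_upwards [self_mem_nhdsWithin] with η hη
  rw [Real.dist_eq, abs_sub_le_iff]
  have hself : ∀ x ∈ K, ∃ y ∈ K, ‖x - y‖ ≤ ‖η - ξ‖ := fun x hx => ⟨x, hx, by simp⟩
  have h2 := energy_le_add_of_near hμ hp0 hp1 hK hK hη hξ le_rfl hself
  have h3 := energy_le_add_of_near hμ hp0 hp1 hK hK hξ hη (norm_sub_rev ξ η).le hself
  constructor <;> simp only [Function.comp_apply] <;> linarith

theorem exists_energy_eq_maxEnergy [IsFiniteMeasure μ] (hμ : ∀ᵐ u ∂μ, ‖u‖ = 1) (hp0 : 0 < p)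
    (hp1 : p < 1) (hK : IsCompact K) (hne : K.Nonempty) :
    ∃ ξ ∈ K, energy p μ K ξ = maxEnergy p μ K :=
  (hK.image_of_continuousOn (continuousOn_energy hμ hp0 hp1 hK)).sSup_mem (hne.image _)

theorem energy_le_maxEnergy [IsFiniteMeasure μ] (hμ : ∀ᵐ u ∂μ, ‖u‖ = 1) (hp0 : 0 < p)
    (hp1 : p < 1) (hK : IsCompact K) (hξ : ξ ∈ K) : energy p μ K ξ ≤ maxEnergy p μ K :=
  le_csSup (hK.image_of_continuousOn (continuousOn_energy hμ hp0 hp1 hK)).bddAbove ⟨ξ, hξ, rfl⟩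

theorem maxEnergy_smul [IsFiniteMeasure μ] (hμ : ∀ᵐ u ∂μ, ‖u‖ = 1) (hp0 : 0 < p)
    (hp1 : p < 1) (hK : IsCompact K) (hne : K.Nonempty) {s : ℝ} (hs : 0 ≤ s) :
    maxEnergy p μ (s • K) = s ^ p * maxEnergy p μ K := by
  refine le_antisymm ?_ ?_
  · obtain ⟨_, ⟨ξ, hξ, rfl⟩, h⟩ := exists_energy_eq_maxEnergy hμ hp0 hp1 (hK.smul s) hne.smul_set
    rw [← h]
    simp only
    rw [energy_smul hK hξ hs]
    gcongr
    exact energy_le_maxEnergy hμ hp0 hp1 hK hξ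
  · obtain ⟨ξ, hξ, h⟩ := exists_energy_eq_maxEnergy hμ hp0 hp1 hK hne
    rw [← h, ← energy_smul hK hξ hs]
    exact energy_le_maxEnergy hμ hp0 hp1 (hK.smul s) (smul_mem_smul_set hξ)

theorem maxEnergy_recenter (hK : IsCompact K) (hne : K.Nonempty) (o : Eu n) :
    maxEnergy p μ (recenter K o) = maxEnergy p μ K := by
  have h : energy p μ (recenter K o) '' recenter K o = energy p μ K '' K := by
    conv_lhs => rw [recenter_eq_image K o, image_image, ← recenter_eq_image K o]
    exact image_congr fun ξ _ => energy_recenter hK hne o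
  rw [maxEnergy, h, maxEnergy]

theorem continuous_maxEnergy [IsFiniteMeasure μ] (hμ : ∀ᵐ u ∂μ, ‖u‖ = 1) (hp0 : 0 < p)
    (hp1 : p < 1) :
    Continuous fun K : TopologicalSpace.NonemptyCompacts (Eu n) => maxEnergy p μ K := by
  have key : ∀ K L : TopologicalSpace.NonemptyCompacts (Eu n), ∀ δ, dist K L < δ →
      maxEnergy p μ K ≤ maxEnergy p μ L + μ.real univ * (2 * δ) ^ p := by
    intro K L δ hδ
    rw [NonemptyCompacts.dist_eq] at hδ
    have hfin : hausdorffEDist (K : Set (Eu n)) L ≠ ⊤ :=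
      hausdorffEDist_ne_top_of_nonempty_of_bounded K.nonempty L.nonempty K.isCompact.isBounded
        L.isCompact.isBounded
    have hnear : ∀ x ∈ (K : Set (Eu n)), ∃ y ∈ (L : Set (Eu n)), ‖x - y‖ ≤ δ := fun x hx => by
      obtain ⟨y, hy, h⟩ := exists_dist_lt_of_hausdorffDist_lt hx hδ hfin
      exact ⟨y, hy, by rw [← dist_eq_norm]; exact h.le⟩
    obtain ⟨ξ, hξ, h⟩ := exists_energy_eq_maxEnergy hμ hp0 hp1 K.isCompact K.nonempty
    obtain ⟨η, hη, hξη⟩ := hnear ξ hξ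
    rw [← h]
    refine (energy_le_add_of_near hμ hp0 hp1 K.isCompact L.isCompact hξ hη hξη hnear).trans ?_
    gcongr
    exact energy_le_maxEnergy hμ hp0 hp1 L.isCompact hη
  rw [continuous_iff_continuousAt]
  intro L
  rw [Metric.continuousAt_iff]
  intro ε hε
  have h1 := (tendsto_const_mul_two_mul_rpow hp0 (μ.real univ)).eventually_lt_const hε
  obtain ⟨δ, hδ0, hδ⟩ := ((h1.filter_mono (nhdsWithin_le_nhds (s := Ioi 0))).and
    self_mem_nhdsWithin).exists
  refine ⟨δ, hδ, fun K hKL => ?_⟩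
  rw [Real.dist_eq, abs_sub_lt_iff]
  have h2 := key K L δ hKL
  have h3 := key L K δ (by rwa [dist_comm])
  constructor <;> linarith

end Energy

section Nondegenerate

variable {m : ℕ} {K : Set (Eu (m + 1))} {p : ℝ} {μ : Measure (Eu (m + 1))}

theorem exists_pos_mul_norm_rpow_le_integral [IsFiniteMeasure μ] (hμ : ∀ᵐ u ∂μ, ‖u‖ = 1)
    (hp0 : 0 < p) (hd : ¬ ∃ L : Submodule ℝ (Eu (m + 1)), Module.finrank ℝ L = m ∧
      μ ((L : Set (Eu (m + 1)))ᶜ) = 0) :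
    ∃ c, 0 < c ∧ ∀ w, c * ‖w‖ ^ p ≤ ∫ u, |⟪w, u⟫| ^ p ∂μ := by
  have hint : ∀ w, Integrable (fun u => |⟪w, u⟫| ^ p) μ := fun w =>
    integrable_of_continuous_of_ae_norm_eq_one hμ
      ((by fun_prop : Continuous fun u => |⟪w, u⟫|).rpow_const fun _ => Or.inr hp0.le)
  have hcont : ContinuousOn (fun w => ∫ u, |⟪w, u⟫| ^ p ∂μ) (sphere 0 1) := by
    refine continuousOn_of_dominated (bound := fun _ => 1) (fun w _ => (hint w).1) (fun w hw => ?_)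
      (integrable_const _) (Eventually.of_forall fun u => ?_)
    · filter_upwards [hμ] with u hu
      rw [Real.norm_of_nonneg (by positivity)]
      refine Real.rpow_le_one (abs_nonneg _) ?_ hp0.le
      simpa [hu, mem_sphere_zero_iff_norm.1 hw] using abs_real_inner_le_norm w u
    · exact ((by fun_prop : Continuous fun w => |⟪w, u⟫|).rpow_const
        fun _ => Or.inr hp0.le).continuousOn
  obtain ⟨w, hw, hmin⟩ := (isCompact_sphere (0 : Eu (m + 1)) 1).exists_isMinOn
    (NormedSpace.sphere_nonempty.2 zero_le_one) hcont
  have hw0 : w ≠ 0 := by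
    rintro rfl
    simp at hw
  refine ⟨∫ u, |⟪w, u⟫| ^ p ∂μ, ?_, fun z => ?_⟩
  · refine (integral_nonneg fun u => by positivity).lt_of_ne fun h0 => hd ⟨(ℝ ∙ w)ᗮ, ?_, ?_⟩
    · have : Fact (Module.finrank ℝ (Eu (m + 1)) = m + 1) := ⟨by simp⟩
      exact Submodule.finrank_orthogonal_span_singleton hw0
    · have h1 := (integral_eq_zero_iff_of_nonneg (fun u => by positivity) (hint w)).1 h0.symm
      refine measure_mono_null (fun u hu => ?_) (ae_iff.1 h1)
      intro h2
      refine hu (Submodule.mem_orthogonal_singleton_iff_inner_right.2 ?_)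
      simpa using (Real.rpow_eq_zero (abs_nonneg _) hp0.ne').1 h2
  · rcases eq_or_ne z 0 with rfl | hz
    · simp [Real.zero_rpow hp0.ne']
    have hz' := norm_pos_iff.2 hz
    have h1 : ∫ u, |⟪w, u⟫| ^ p ∂μ ≤ ∫ u, |⟪‖z‖⁻¹ • z, u⟫| ^ p ∂μ :=
      hmin (by simp [norm_smul, hz'.ne'])
    have h2 : ∫ u, |⟪‖z‖⁻¹ • z, u⟫| ^ p ∂μ = (‖z‖ ^ p)⁻¹ * ∫ u, |⟪z, u⟫| ^ p ∂μ := by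
      rw [← integral_const_mul]
      congr 1
      ext u
      rw [real_inner_smul_left, abs_mul, abs_of_pos (inv_pos.2 hz'),
        Real.mul_rpow (by positivity) (abs_nonneg _), Real.inv_rpow (norm_nonneg _)]
    rwa [h2, ← div_eq_inv_mul, le_div_iff₀ (by positivity)] at h1

theorem mul_norm_rpow_le_maxEnergy [IsFiniteMeasure μ] (hμ : ∀ᵐ u ∂μ, ‖u‖ = 1)
    (hp0 : 0 < p) (hp1 : p < 1) {c : ℝ} (hc : ∀ w, c * ‖w‖ ^ p ≤ ∫ u, |⟪w, u⟫| ^ p ∂μ)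
    (hcv : Convex ℝ K) (hK : IsCompact K) {x y : Eu (m + 1)} (hx : x ∈ K) (hy : y ∈ K) :
    c * (‖x - y‖ / 2) ^ p ≤ maxEnergy p μ K := by
  have hξ : (2⁻¹ : ℝ) • x + (2⁻¹ : ℝ) • y ∈ K := hcv hx hy (by norm_num) (by norm_num) (by norm_num)
  have h1 := hc ((2⁻¹ : ℝ) • (x - y))
  rw [norm_smul, Real.norm_of_nonneg (by norm_num), ← div_eq_inv_mul] at h1
  refine h1.trans ((integral_mono_of_nonneg (Eventually.of_forall fun u => by positivity)
    (integrable_energy hμ hp0 hK ⟨x, hx⟩ ((2⁻¹ : ℝ) • x + (2⁻¹ : ℝ) • y))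
    (Eventually.of_forall fun u => ?_)).trans (energy_le_maxEnergy hμ hp0 hp1 hK hξ))
  refine Real.rpow_le_rpow (abs_nonneg _) (abs_le.2 ?_) hp0.le
  have h2 := inner_le_suppFn hK hx u
  have h3 := inner_le_suppFn hK hy u
  simp only [inner_add_left, real_inner_smul_left, inner_sub_left]
  constructor <;> linarith

end Nondegenerate

section Minimizer

open TopologicalSpace

variable {n : ℕ}

theorem NonemptyCompacts.exists_dist_le_of_dist_lt {K L : NonemptyCompacts (Eu n)} {δ : ℝ}
    (h : dist K L < δ) {x : Eu n} (hx : x ∈ (K : Set (Eu n))) :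
    ∃ y ∈ (L : Set (Eu n)), dist x y < δ := by
  rw [NonemptyCompacts.dist_eq] at h
  exact exists_dist_lt_of_hausdorffDist_lt hx h (hausdorffEDist_ne_top_of_nonempty_of_bounded
    K.nonempty L.nonempty K.isCompact.isBounded L.isCompact.isBounded)

theorem isClosed_setOf_convex :
    IsClosed {K : NonemptyCompacts (Eu n) | Convex ℝ (K : Set (Eu n))} := by
  refine isClosed_of_closure_subset fun K hK => ?_
  rw [Metric.mem_closure_iff] at hK
  intro x hx y hy a b ha hb hab
  rw [← K.isCompact.isClosed.closure_eq, Metric.mem_closure_iff]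
  intro ε hε
  obtain ⟨L, hL, hKL⟩ := hK (ε / 2) (by positivity)
  obtain ⟨x', hx', hxx⟩ := NonemptyCompacts.exists_dist_le_of_dist_lt hKL hx
  obtain ⟨y', hy', hyy⟩ := NonemptyCompacts.exists_dist_le_of_dist_lt hKL hy
  obtain ⟨z, hz, hzz⟩ := NonemptyCompacts.exists_dist_le_of_dist_lt (by rwa [dist_comm])
    (hL hx' hy' ha hb hab)
  refine ⟨z, hz, (dist_triangle _ _ _).trans_lt ((add_lt_add_of_le_of_lt ?_ hzz).trans_eq
    (add_halves ε))⟩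
  rw [dist_eq_norm] at hxx hyy ⊢
  have : a • x + b • y - (a • x' + b • y') = a • (x - x') + b • (y - y') := by module
  rw [this]
  refine (norm_add_le _ _).trans ?_
  rw [norm_smul, norm_smul, Real.norm_of_nonneg ha, Real.norm_of_nonneg hb]
  have h1 := mul_le_mul_of_nonneg_left hxx.le ha
  have h2 := mul_le_mul_of_nonneg_left hyy.le hb
  have h3 : ε / 2 = a * (ε / 2) + b * (ε / 2) := by rw [← add_mul, hab, one_mul]
  linarith

theorem isClosed_setOf_le_volume (c : ℝ≥0∞) :
    IsClosed {K : NonemptyCompacts (Eu n) | c ≤ volume (K : Set (Eu n))} := by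
  refine isClosed_of_closure_subset fun K hK => ?_
  rw [Metric.mem_closure_iff] at hK
  have h1 : Tendsto (fun r => volume (cthickening r (K : Set (Eu n)))) (𝓝[>] 0)
      (𝓝 (volume (K : Set (Eu n)))) :=
    (tendsto_measure_cthickening_of_isCompact K.isCompact).mono_left nhdsWithin_le_nhds
  refine ge_of_tendsto h1 ?_
  filter_upwards [self_mem_nhdsWithin] with r hr
  obtain ⟨L, hL, hKL⟩ := hK r hr
  refine le_trans hL (measure_mono fun x hx => ?_)
  obtain ⟨y, hy, h⟩ := NonemptyCompacts.exists_dist_le_of_dist_lt (by rwa [dist_comm]) hx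
  exact mem_cthickening_of_dist_le x y r _ hy h.le

variable {m : ℕ} {K L : Set (Eu (m + 1))} {p : ℝ} {μ : Measure (Eu (m + 1))}

theorem volume_real_smul (K : Set (Eu (m + 1))) {s : ℝ} (hs : 0 ≤ s) :
    volume.real (s • K) = s ^ (m + 1) * volume.real K := by
  rw [measureReal_def, Measure.addHaar_smul, ENNReal.toReal_mul, ← measureReal_def,
    ENNReal.toReal_ofReal (abs_nonneg _), finrank_euclideanSpace_fin, abs_of_nonneg (by positivity)]

theorem volume_recenter (K : Set (Eu (m + 1))) (o : Eu (m + 1)) :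
    volume (recenter K o) = volume K :=
  measure_preimage_add_right volume o K

theorem volume_real_rpow_smul (hL : 0 < volume.real L) :
    volume.real ((volume.real L ^ (-(m + 1 : ℝ)⁻¹)) • L) = 1 := by
  have h : (0 : ℝ) < m + 1 := by positivity
  rw [volume_real_smul _ (by positivity), ← Real.rpow_natCast, ← Real.rpow_mul hL.le]
  push_cast
  rw [neg_mul, inv_mul_cancel₀ h.ne', Real.rpow_neg_one, inv_mul_cancel₀ hL.ne']

theorem interior_nonempty_of_volume_pos (hc : Convex ℝ K) (hK : IsCompact K)
    (hv : 0 < volume.real K) : (interior K).Nonempty := by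
  by_contra! h
  have h1 := hc.addHaar_frontier volume
  rw [frontier, h, sdiff_empty, hK.isClosed.closure_eq] at h1
  rw [measureReal_def, h1] at hv
  simp at hv

theorem maxEnergy_nonneg (hK : IsCompact K) : 0 ≤ maxEnergy p μ K := by
  refine Real.sSup_nonneg ?_
  rintro _ ⟨ξ, hξ, rfl⟩
  exact integral_nonneg fun u => Real.rpow_nonneg (suppFn_sub_inner_nonneg hK hξ u) p

theorem exists_maxEnergy_minimal_of_subset_closedBall [IsFiniteMeasure μ]
    (hμ : ∀ᵐ u ∂μ, ‖u‖ = 1) (hp0 : 0 < p) (hp1 : p < 1) {B : Set (Eu (m + 1))} {R : ℝ}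
    (hBc : Convex ℝ B) (hB : IsCompact B) (hBne : B.Nonempty) (hBv : 1 ≤ volume B)
    (hBR : B ⊆ closedBall 0 R) :
    ∃ K : Set (Eu (m + 1)), Convex ℝ K ∧ IsCompact K ∧ 1 ≤ volume K ∧
      ∀ L : Set (Eu (m + 1)), Convex ℝ L → IsCompact L → L.Nonempty → 1 ≤ volume L →
        L ⊆ closedBall 0 R → maxEnergy p μ K ≤ maxEnergy p μ L := by
  have hA := (NonemptyCompacts.isCompact_subsets_of_isCompact
    (isCompact_closedBall (0 : Eu (m + 1)) R)).inter_right
      (isClosed_setOf_convex.inter (isClosed_setOf_le_volume 1))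
  obtain ⟨K, hK, hmin⟩ := hA.exists_isMinOn ⟨⟨⟨B, hB⟩, hBne⟩, hBR, hBc, hBv⟩
    (continuous_maxEnergy hμ hp0 hp1).continuousOn
  refine ⟨K, hK.2.1, K.isCompact, hK.2.2, fun L hLc hL hLne hLv hLR => ?_⟩
  exact hmin (a := ⟨⟨L, hL⟩, hLne⟩) ⟨hLR, hLc, hLv⟩

theorem exists_maxEnergy_minimal [IsFiniteMeasure μ] (hμ : ∀ᵐ u ∂μ, ‖u‖ = 1)
    (hp0 : 0 < p) (hp1 : p < 1) {c : ℝ} (hc0 : 0 < c)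
    (hc : ∀ w, c * ‖w‖ ^ p ≤ ∫ u, |⟪w, u⟫| ^ p ∂μ) :
    ∃ K : Set (Eu (m + 1)), Convex ℝ K ∧ IsCompact K ∧ 1 ≤ volume.real K ∧
      ∀ L : Set (Eu (m + 1)), Convex ℝ L → IsCompact L → 1 ≤ volume.real L →
        maxEnergy p μ K ≤ maxEnergy p μ L := by
  have hone : ∀ L : Set (Eu (m + 1)), IsCompact L → (1 ≤ volume.real L ↔ 1 ≤ volume L) := by
    intro L hL
    rw [measureReal_def, ← ENNReal.ofReal_le_iff_le_toReal hL.measure_lt_top.ne, ENNReal.ofReal_one]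
  have hne : ∀ L : Set (Eu (m + 1)), 1 ≤ volume.real L → L.Nonempty := by
    intro L hL
    by_contra! h
    rw [h] at hL
    norm_num at hL
  have hball : 0 < volume.real (closedBall (0 : Eu (m + 1)) 1) :=
    ENNReal.toReal_pos (measure_closedBall_pos _ _ one_pos).ne' measure_closedBall_lt_top.ne
  obtain ⟨B, hBc, hB, hBv⟩ : ∃ B : Set (Eu (m + 1)), Convex ℝ B ∧ IsCompact B ∧
      1 ≤ volume.real B :=
    ⟨_, (convex_closedBall 0 1).smul _, (isCompact_closedBall 0 1).smul _,
      (volume_real_rpow_smul hball).ge⟩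
  obtain ⟨R₀, hR₀⟩ := hB.isBounded.subset_closedBall 0
  set b := maxEnergy p μ B with hb
  have hb0 : 0 ≤ b := maxEnergy_nonneg hB
  set R₁ : ℝ := 2 * (b / c) ^ p⁻¹ with hR₁
  have hR₁0 : 0 ≤ R₁ := by positivity
  obtain ⟨K, hKc, hK, hKv, hmin⟩ := exists_maxEnergy_minimal_of_subset_closedBall hμ hp0 hp1
    hBc hB (hne B hBv) ((hone B hB).1 hBv)
    (hR₀.trans (closedBall_subset_closedBall (le_max_left R₀ R₁)))
  refine ⟨K, hKc, hK, (hone K hK).2 hKv, fun L hLc hL hLv => ?_⟩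
  rcases lt_or_ge b (maxEnergy p μ L) with h | h
  · refine le_trans (hmin B hBc hB (hne B hBv) ((hone B hB).1 hBv) ?_) h.le
    exact hR₀.trans (closedBall_subset_closedBall (le_max_left R₀ R₁))
  obtain ⟨o, ho⟩ := hne L hLv
  have hL' : IsCompact (recenter L o) := by
    rw [recenter_eq_image]
    exact hL.image (by fun_prop)
  have hvol : 1 ≤ volume.real (recenter L o) := by
    rwa [measureReal_def, volume_recenter, ← measureReal_def]
  rw [← maxEnergy_recenter hL (hne L hLv) o]
  refine hmin _ (hLc.translate_preimage_left o) hL' (hne _ hvol) ((hone _ hL').1 hvol)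
    fun x hx => closedBall_subset_closedBall (le_max_right R₀ R₁) ?_
  rw [mem_closedBall_zero_iff]
  have h1 := (mul_norm_rpow_le_maxEnergy hμ hp0 hp1 hc hLc hL (show x + o ∈ L from hx) ho).trans h
  rw [add_sub_cancel_right, ← le_div_iff₀' hc0] at h1
  have h2 := Real.rpow_le_rpow (by positivity) h1 (inv_nonneg.2 hp0.le)
  rw [Real.rpow_rpow_inv (by positivity) hp0.ne'] at h2
  linarith

/-- The bodies which minimize the maximal energy relative to their volume, positioned so that the
maximum is attained at the origin and scaled so that it is `κ` times the volume. -/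
structure IsMinimizer (p : ℝ) (μ : Measure (Eu (m + 1))) (κ : ℝ) (K : Set (Eu (m + 1))) :
    Prop where
  convex : Convex ℝ K
  isCompact : IsCompact K
  zero_mem : 0 ∈ K
  volume_pos : 0 < volume.real K
  energy_zero : energy p μ K 0 = κ * volume.real K
  energy_le : ∀ ξ ∈ K, energy p μ K ξ ≤ energy p μ K 0
  le_maxEnergy : ∀ L : Set (Eu (m + 1)), Convex ℝ L → IsCompact L → 0 < volume.real L →
    energy p μ K 0 * (volume.real L / volume.real K) ^ (p / (m + 1)) ≤ maxEnergy p μ L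

theorem exists_isMinimizer [IsFiniteMeasure μ] (hμ : ∀ᵐ u ∂μ, ‖u‖ = 1)
    (hp0 : 0 < p) (hp1 : p < 1) (hd : ¬ ∃ L : Submodule ℝ (Eu (m + 1)),
      Module.finrank ℝ L = m ∧ μ ((L : Set (Eu (m + 1)))ᶜ) = 0) {κ : ℝ} (hκ : 0 < κ) :
    ∃ K : Set (Eu (m + 1)), IsMinimizer p μ κ K := by
  obtain ⟨c, hc0, hc⟩ := exists_pos_mul_norm_rpow_le_integral hμ hp0 hd
  obtain ⟨K₀, hcv, hK₀, hv, hmin⟩ := exists_maxEnergy_minimal hμ hp0 hp1 hc0 hc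
  have hv0 : 0 < volume.real K₀ := one_pos.trans_le hv
  obtain ⟨x, hx⟩ := interior_nonempty_of_volume_pos hcv hK₀ hv0
  have hne : K₀.Nonempty := ⟨x, interior_subset hx⟩
  set M := maxEnergy p μ K₀ with hM
  have hM0 : 0 < M := by
    obtain ⟨r, hr0, hr⟩ := Metric.isOpen_iff.1 isOpen_interior x hx
    obtain ⟨w, hw⟩ := exists_norm_eq (Eu (m + 1)) (half_pos hr0).le
    have hy : x + w ∈ K₀ := interior_subset (hr (by simp [hw, half_lt_self hr0]))
    refine lt_of_lt_of_le ?_ (mul_norm_rpow_le_maxEnergy hμ hp0 hp1 hc hcv hK₀ hy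
      (interior_subset hx))
    rw [add_sub_cancel_left, hw]
    positivity
  obtain ⟨o, ho, hoM⟩ := exists_energy_eq_maxEnergy hμ hp0 hp1 hK₀ hne
  have hm : (0 : ℝ) < m + 1 := by positivity
  have hmp : 0 < m + 1 - p := by
    have : (0 : ℝ) ≤ m := Nat.cast_nonneg m
    linarith
  set s : ℝ := (M / (κ * volume.real K₀)) ^ (m + 1 - p)⁻¹ with hs
  have hs0 : 0 < s := by positivity
  have hsM : s ^ p * M = κ * (s ^ (m + 1) * volume.real K₀) := by
    have h1 : s ^ ((m : ℝ) + 1 - p) = M / (κ * volume.real K₀) :=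
      Real.rpow_inv_rpow (by positivity) hmp.ne'
    rw [Real.rpow_sub hs0, div_eq_div_iff (by positivity) (by positivity)] at h1
    have h2 : s ^ ((m : ℝ) + 1) = s ^ (m + 1) := by exact_mod_cast Real.rpow_natCast s (m + 1)
    rw [h2] at h1
    linarith
  have hK₁ : IsCompact (recenter K₀ o) := by
    rw [recenter_eq_image]
    exact hK₀.image (by fun_prop)
  have h0 : (0 : Eu (m + 1)) ∈ recenter K₀ o := by simpa [recenter] using ho
  have hne₁ : (recenter K₀ o).Nonempty := ⟨0, h0⟩
  have hvK : volume.real (s • recenter K₀ o) = s ^ (m + 1) * volume.real K₀ := by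
    rw [volume_real_smul _ hs0.le, measureReal_def, volume_recenter, ← measureReal_def]
  have hE : energy p μ (s • recenter K₀ o) 0 = s ^ p * M := by
    have h1 := energy_smul (p := p) (μ := μ) hK₁ h0 hs0.le
    rw [smul_zero] at h1
    have h2 := energy_recenter (p := p) (μ := μ) (ξ := o) hK₀ hne o
    rw [sub_self] at h2
    rw [h1, h2, hoM]
  refine ⟨s • recenter K₀ o, (hcv.translate_preimage_left o).smul s, hK₁.smul s,
    ⟨0, h0, smul_zero s⟩, ?_, ?_, fun ξ hξ => ?_, fun L hLc hL hLv => ?_⟩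
  · rw [hvK]
    positivity
  · rw [hE, hvK, hsM]
  · refine (energy_le_maxEnergy hμ hp0 hp1 (hK₁.smul s) hξ).trans_eq ?_
    rw [maxEnergy_smul hμ hp0 hp1 hK₁ hne₁ hs0.le, maxEnergy_recenter hK₀ hne, hE]
  · have h1 := hmin _ (hLc.smul _) (hL.smul _) (volume_real_rpow_smul hLv).ge
    have hLne : L.Nonempty := by
      obtain ⟨y, hy⟩ := interior_nonempty_of_volume_pos hLc hL hLv
      exact ⟨y, interior_subset hy⟩
    rw [maxEnergy_smul hμ hp0 hp1 hL hLne (by positivity), ← Real.rpow_mul hLv.le] at h1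
    have h2 : -((m : ℝ) + 1)⁻¹ * p = -(p / (m + 1)) := by ring
    rw [h2, Real.rpow_neg hLv.le, ← div_eq_inv_mul, le_div_iff₀ (by positivity)] at h1
    refine le_trans ?_ h1
    have h3 : (s ^ (m + 1)) ^ (p / ((m : ℝ) + 1)) = s ^ p := by
      rw [← Real.rpow_natCast, ← Real.rpow_mul hs0.le]
      push_cast
      rw [mul_div_cancel₀ _ hm.ne']
    rw [hE, hvK, Real.div_rpow hLv.le (by positivity), Real.mul_rpow (by positivity) hv0.le, h3]
    have h4 : 1 ≤ volume.real K₀ ^ (p / ((m : ℝ) + 1)) :=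
      Real.one_le_rpow hv (by positivity)
    have h5 : s ^ p * M * (volume.real L ^ (p / ((m : ℝ) + 1)) /
        (s ^ p * volume.real K₀ ^ (p / ((m : ℝ) + 1)))) =
        M * volume.real L ^ (p / ((m : ℝ) + 1)) / volume.real K₀ ^ (p / ((m : ℝ) + 1)) := by
      field_simp
    rw [h5]
    exact div_le_self (by positivity) h4

end Minimizer

section Optimality

variable {m : ℕ} {K : Set (Eu (m + 1))} {p κ : ℝ} {μ : Measure (Eu (m + 1))}

theorem rpow_le_add_mul_sub (hp0 : 0 ≤ p) (hp1 : p ≤ 1) {a x : ℝ} (ha : 0 < a) (hx : 0 ≤ x) :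
    x ^ p ≤ a ^ p + p * a ^ (p - 1) * (x - a) := by
  have h1 : -1 ≤ x / a - 1 := by linarith [div_nonneg hx ha.le]
  have h2 := rpow_one_add_le_one_add_mul_self h1 hp0 hp1
  rw [add_sub_cancel, Real.div_rpow hx ha.le, div_le_iff₀ (by positivity)] at h2
  refine h2.trans_eq ?_
  rw [Real.rpow_sub_one ha.ne']
  field_simp

namespace IsMinimizer

theorem nonempty (hK : IsMinimizer p μ κ K) : K.Nonempty := ⟨0, hK.zero_mem⟩

theorem interior_nonempty (hK : IsMinimizer p μ κ K) : (interior K).Nonempty :=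
  interior_nonempty_of_volume_pos hK.convex hK.isCompact hK.volume_pos

theorem suppFn_nonneg (hK : IsMinimizer p μ κ K) (u : Eu (m + 1)) : 0 ≤ suppFn K u := by
  simpa using inner_le_suppFn hK.isCompact hK.zero_mem u

theorem continuous_suppFn (hK : IsMinimizer p μ κ K) : Continuous (suppFn K) :=
  _root_.continuous_suppFn hK.isCompact hK.nonempty

theorem mul_suppFn_le (hK : IsMinimizer p μ κ K) {z : Eu (m + 1)} (hz : z ∈ K) {t : ℝ}
    (ht : 0 ≤ t) (u : Eu (m + 1)) : (1 - t) * suppFn K u ≤ suppFn K u - t * ⟪z, u⟫ := by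
  have := mul_le_mul_of_nonneg_left (inner_le_suppFn hK.isCompact hz u) ht
  linarith

theorem integral_inner_mul_rpow_nonneg [IsFiniteMeasure μ] (hK : IsMinimizer p μ κ K)
    (hμ : ∀ᵐ u ∂μ, ‖u‖ = 1) (hp0 : 0 < p) (hp1 : p < 1) {z : Eu (m + 1)} (hz : z ∈ K) {t : ℝ}
    (ht0 : 0 < t) (ht1 : t ≤ 1) (hpos : ∀ᵐ u ∂μ, 0 < suppFn K u - t * ⟪z, u⟫)
    (hint : Integrable (fun u => ⟪z, u⟫ * (suppFn K u - t * ⟪z, u⟫) ^ (p - 1)) μ) :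
    0 ≤ ∫ u, ⟪z, u⟫ * (suppFn K u - t * ⟪z, u⟫) ^ (p - 1) ∂μ := by
  have htz : t • z ∈ K := hK.convex.smul_mem_of_zero_mem hK.zero_mem hz ⟨ht0.le, ht1⟩
  have h1 := hK.energy_le _ htz
  have h2 := integrable_energy hμ hp0 hK.isCompact hK.nonempty (t • z)
  have h3 : energy p μ K 0 ≤ energy p μ K (t • z) +
      p * t * ∫ u, ⟪z, u⟫ * (suppFn K u - t * ⟪z, u⟫) ^ (p - 1) ∂μ := by
    rw [energy, energy, ← integral_const_mul, ← integral_add h2 (hint.const_mul _)]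
    refine integral_mono_ae (integrable_energy hμ hp0 hK.isCompact hK.nonempty 0)
      (h2.add (hint.const_mul _)) ?_
    filter_upwards [hpos] with u hu
    have := rpow_le_add_mul_sub hp0.le hp1.le hu (hK.suppFn_nonneg u)
    simp only [inner_zero_left, sub_zero, real_inner_smul_left]
    linarith
  have h4 : 0 ≤ p * t * ∫ u, ⟪z, u⟫ * (suppFn K u - t * ⟪z, u⟫) ^ (p - 1) ∂μ := by linarith
  exact nonneg_of_mul_nonneg_right h4 (by positivity)

theorem rpow_suppFn_sub_le (hK : IsMinimizer p μ κ K) (hp0 : 0 < p) (hp1 : p < 1)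
    {z u : Eu (m + 1)} (hz : z ∈ K) {t : ℝ} (ht0 : 0 ≤ t) (ht1 : t ≤ 1 / 2)
    (hu : 0 < suppFn K u) :
    (suppFn K u - t * ⟪z, u⟫) ^ (p - 1) ≤ 2 * suppFn K u ^ (p - 1) := by
  have h1 : suppFn K u / 2 ≤ suppFn K u - t * ⟪z, u⟫ :=
    le_trans (by nlinarith) (hK.mul_suppFn_le hz ht0 u)
  refine (Real.rpow_le_rpow_of_nonpos (by positivity) h1 (by linarith)).trans ?_
  rw [Real.div_rpow hu.le zero_le_two, div_eq_mul_inv, mul_comm, ← Real.rpow_neg zero_le_two]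
  have : (2 : ℝ) ^ (-(p - 1)) ≤ 2 := by
    calc (2 : ℝ) ^ (-(p - 1)) ≤ 2 ^ (1 : ℝ) :=
          Real.rpow_le_rpow_of_exponent_le one_le_two (by linarith)
      _ = 2 := Real.rpow_one 2
  gcongr

theorem lintegral_suppFn_rpow_lt_top [IsFiniteMeasure μ] (hK : IsMinimizer p μ κ K)
    (hμ : ∀ᵐ u ∂μ, ‖u‖ = 1) (hp0 : 0 < p) (hp1 : p < 1) :
    ∫⁻ u, ENNReal.ofReal (suppFn K u) ^ (p - 1) ∂μ < ⊤ := by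
  obtain ⟨o, ho⟩ := hK.interior_nonempty
  obtain ⟨r, hr0, hr⟩ := Metric.nhds_basis_closedBall.mem_iff.1 (mem_interior_iff_mem_nhds.1 ho)
  have hoK : o ∈ K := interior_subset ho
  have hlow : ∀ u : Eu (m + 1), ‖u‖ = 1 → ⟪o, u⟫ + r ≤ suppFn K u := by
    intro u hu
    have h1 : o + r • u ∈ K := hr (by simp [norm_smul, hu, abs_of_pos hr0])
    have h2 := inner_le_suppFn hK.isCompact h1 u
    rwa [inner_add_left, real_inner_smul_left, real_inner_self_eq_norm_sq, hu, one_pow,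
      mul_one] at h2
  have hpos : ∀ t : ℝ, 0 < t → t ≤ 1 → ∀ u : Eu (m + 1), ‖u‖ = 1 →
      t * r ≤ suppFn K u - t * ⟪o, u⟫ := by
    intro t ht0 ht1 u hu
    have h1 := mul_le_mul_of_nonneg_left (hlow u hu) ht0.le
    have h2 := mul_le_mul_of_nonneg_right ht1 (hK.suppFn_nonneg u)
    linarith
  have hmeas : ∀ t : ℝ, Measurable fun u => suppFn K u - t * ⟪o, u⟫ := fun t =>
    (hK.continuous_suppFn.sub (by fun_prop)).measurable
  have hint : ∀ t : ℝ, 0 < t → t ≤ 1 →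
      Integrable (fun u => (suppFn K u - t * ⟪o, u⟫) ^ (p - 1)) μ := by
    intro t ht0 ht1
    refine Integrable.of_bound ((hmeas t).pow_const _).aestronglyMeasurable
      ((t * r) ^ (p - 1)) ?_
    filter_upwards [hμ] with u hu
    have h1 := hpos t ht0 ht1 u hu
    have h2 : 0 < t * r := by positivity
    rw [Real.norm_of_nonneg (Real.rpow_nonneg (h2.le.trans h1) _)]
    exact Real.rpow_le_rpow_of_nonpos h2 h1 (by linarith)
  have hmul : ∀ t : ℝ, 0 < t → t ≤ 1 → ∀ g : Eu (m + 1) → ℝ, Continuous g →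
      Integrable (fun u => g u * (suppFn K u - t * ⟪o, u⟫) ^ (p - 1)) μ := by
    intro t ht0 ht1 g hg
    obtain ⟨C, hC⟩ := (isCompact_sphere (0 : Eu (m + 1)) 1).exists_bound_of_continuousOn
      hg.continuousOn
    refine (hint t ht0 ht1).bdd_mul hg.aestronglyMeasurable (c := C) ?_
    filter_upwards [hμ] with u hu using hC u (by simpa using hu)
  have hbound : ∀ t : ℝ, 0 < t → t ≤ 1 / 2 →
      ∫⁻ u, ENNReal.ofReal (suppFn K u - t * ⟪o, u⟫) ^ (p - 1) ∂μ ≤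
        ENNReal.ofReal (2 * energy p μ K 0 / r) := by
    intro t ht0 ht2
    have ht1 : t ≤ 1 := by linarith
    have hp : ∀ᵐ u ∂μ, 0 < suppFn K u - t * ⟪o, u⟫ := by
      filter_upwards [hμ] with u hu using (by positivity : 0 < t * r).trans_le (hpos t ht0 ht1 u hu)
    have h1 : ∫⁻ u, ENNReal.ofReal (suppFn K u - t * ⟪o, u⟫) ^ (p - 1) ∂μ =
        ENNReal.ofReal (∫ u, (suppFn K u - t * ⟪o, u⟫) ^ (p - 1) ∂μ) := by
      rw [ofReal_integral_eq_lintegral_ofReal (hint t ht0 ht1)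
        (hp.mono fun u hu => Real.rpow_nonneg hu.le _)]
      exact lintegral_congr_ae (hp.mono fun u hu => ENNReal.ofReal_rpow_of_pos hu)
    rw [h1]
    refine ENNReal.ofReal_le_ofReal ?_
    have hi1 := hmul t ht0 ht1 (fun u => ⟪o, u⟫) (by fun_prop)
    have h2 := hK.integral_inner_mul_rpow_nonneg hμ hp0 hp1 hoK ht0 ht1 hp hi1
    have hi2 := (integrable_energy hμ hp0 hK.isCompact hK.nonempty 0).const_mul 2
    have h3 : r * ∫ u, (suppFn K u - t * ⟪o, u⟫) ^ (p - 1) ∂μ +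
        ∫ u, ⟪o, u⟫ * (suppFn K u - t * ⟪o, u⟫) ^ (p - 1) ∂μ ≤ 2 * energy p μ K 0 := by
      rw [energy, ← integral_const_mul, ← integral_const_mul,
        ← integral_add ((hint t ht0 ht1).const_mul r) hi1]
      refine integral_mono_ae (((hint t ht0 ht1).const_mul r).add hi1) hi2 ?_
      filter_upwards [hμ, hp] with u hu hu0
      have h4 := hlow u hu
      have h5 : 0 ≤ (suppFn K u - t * ⟪o, u⟫) ^ (p - 1) := Real.rpow_nonneg hu0.le _
      simp only [inner_zero_left, sub_zero]
      rw [← add_mul, add_comm r]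
      refine (mul_le_mul_of_nonneg_right h4 h5).trans ?_
      rcases (hK.suppFn_nonneg u).eq_or_lt with h0 | h0
      · rw [← h0, zero_mul, Real.zero_rpow hp0.ne', mul_zero]
      · have h6 := hK.rpow_suppFn_sub_le hp0 hp1 hoK ht0.le ht2 h0
        calc suppFn K u * (suppFn K u - t * ⟪o, u⟫) ^ (p - 1)
            ≤ suppFn K u * (2 * suppFn K u ^ (p - 1)) := by gcongr
          _ = 2 * suppFn K u ^ p := by
            rw [Real.rpow_sub_one h0.ne']
            field_simp
    rw [le_div_iff₀' hr0]
    linarith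
  set t : ℕ → ℝ := fun k => 1 / 2 * (1 / ((k : ℝ) + 1)) with ht
  have ht0 : ∀ k, 0 < t k := fun k => by positivity
  have ht2 : ∀ k, t k ≤ 1 / 2 := fun k => by
    have : 1 / ((k : ℝ) + 1) ≤ 1 := by
      rw [div_le_one (by positivity)]
      linarith [(Nat.cast_nonneg k : (0 : ℝ) ≤ k)]
    simp only [ht]
    linarith
  have htt : Tendsto t atTop (𝓝 0) := by
    have := (tendsto_one_div_add_atTop_nhds_zero_nat (𝕜 := ℝ)).const_mul (1 / 2)
    rwa [mul_zero] at this
  have hlim : ∀ u, Tendsto (fun k => ENNReal.ofReal (suppFn K u - t k * ⟪o, u⟫) ^ (p - 1)) atTop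
      (𝓝 (ENNReal.ofReal (suppFn K u) ^ (p - 1))) := by
    intro u
    have h1 : Tendsto (fun k => suppFn K u - t k * ⟪o, u⟫) atTop (𝓝 (suppFn K u)) := by
      simpa using (htt.mul_const ⟪o, u⟫).const_sub (suppFn K u)
    exact (ENNReal.continuous_rpow_const.tendsto _).comp (ENNReal.tendsto_ofReal h1)
  calc ∫⁻ u, ENNReal.ofReal (suppFn K u) ^ (p - 1) ∂μ
      = ∫⁻ u, liminf (fun k => ENNReal.ofReal (suppFn K u - t k * ⟪o, u⟫) ^ (p - 1)) atTop ∂μ :=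
        lintegral_congr fun u => (hlim u).liminf_eq.symm
    _ ≤ liminf (fun k => ∫⁻ u, ENNReal.ofReal (suppFn K u - t k * ⟪o, u⟫) ^ (p - 1) ∂μ) atTop :=
        lintegral_liminf_le fun k => (hmeas (t k)).ennreal_ofReal.pow_const _
    _ ≤ ENNReal.ofReal (2 * energy p μ K 0 / r) :=
        liminf_le_of_frequently_le' (Frequently.of_forall fun k => hbound _ (ht0 k) (ht2 k))
    _ < ⊤ := ENNReal.ofReal_lt_top

theorem ae_suppFn_pos [IsFiniteMeasure μ] (hK : IsMinimizer p μ κ K) (hμ : ∀ᵐ u ∂μ, ‖u‖ = 1)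
    (hp0 : 0 < p) (hp1 : p < 1) : ∀ᵐ u ∂μ, 0 < suppFn K u := by
  have h := ae_lt_top (hK.continuous_suppFn.measurable.ennreal_ofReal.pow_const (p - 1))
    (hK.lintegral_suppFn_rpow_lt_top hμ hp0 hp1).ne
  filter_upwards [h] with u hu
  refine (hK.suppFn_nonneg u).lt_of_ne fun h0 => ?_
  rw [← h0, ENNReal.ofReal_zero, ENNReal.zero_rpow_of_neg (by linarith)] at hu
  exact hu.ne rfl

theorem integrable_suppFn_rpow [IsFiniteMeasure μ] (hK : IsMinimizer p μ κ K)
    (hμ : ∀ᵐ u ∂μ, ‖u‖ = 1) (hp0 : 0 < p) (hp1 : p < 1) :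
    Integrable (fun u => suppFn K u ^ (p - 1)) μ := by
  refine ⟨(hK.continuous_suppFn.measurable.pow_const _).aestronglyMeasurable, ?_⟩
  rw [hasFiniteIntegral_iff_ofReal
    (Eventually.of_forall fun u => Real.rpow_nonneg (hK.suppFn_nonneg u) _)]
  refine lt_of_eq_of_lt (lintegral_congr_ae ?_) (hK.lintegral_suppFn_rpow_lt_top hμ hp0 hp1)
  filter_upwards [hK.ae_suppFn_pos hμ hp0 hp1] with u hu
  exact (ENNReal.ofReal_rpow_of_pos hu).symm

theorem integrable_mul_suppFn_rpow [IsFiniteMeasure μ] (hK : IsMinimizer p μ κ K)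
    (hμ : ∀ᵐ u ∂μ, ‖u‖ = 1) (hp0 : 0 < p) (hp1 : p < 1) {f : Eu (m + 1) → ℝ}
    (hf : Continuous f) : Integrable (fun u => suppFn K u ^ (p - 1) * f u) μ := by
  obtain ⟨C, hC⟩ := (isCompact_sphere (0 : Eu (m + 1)) 1).exists_bound_of_continuousOn
    hf.continuousOn
  refine (hK.integrable_suppFn_rpow hμ hp0 hp1).mul_bdd hf.aestronglyMeasurable (c := C) ?_
  filter_upwards [hμ] with u hu using hC u (by simpa using hu)

theorem integral_suppFn_rpow_mul_inner_nonneg [IsFiniteMeasure μ] (hK : IsMinimizer p μ κ K)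
    (hμ : ∀ᵐ u ∂μ, ‖u‖ = 1) (hp0 : 0 < p) (hp1 : p < 1) {z : Eu (m + 1)} (hz : z ∈ K) :
    0 ≤ ∫ u, suppFn K u ^ (p - 1) * ⟪z, u⟫ ∂μ := by
  have hpos := hK.ae_suppFn_pos hμ hp0 hp1
  have hev : ∀ᶠ t : ℝ in 𝓝[>] 0, 0 < t ∧ t ≤ 1 / 2 := by
    filter_upwards [Ioc_mem_nhdsGT (show (0 : ℝ) < 1 / 2 by norm_num)] with t ht using ht
  have hmeas : ∀ t : ℝ, Measurable fun u => ⟪z, u⟫ * (suppFn K u - t * ⟪z, u⟫) ^ (p - 1) :=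
    fun t => (by fun_prop : Continuous fun u => ⟪z, u⟫).measurable.mul
      ((hK.continuous_suppFn.sub (by fun_prop)).measurable.pow_const _)
  have hb : ∀ t : ℝ, 0 < t ∧ t ≤ 1 / 2 → ∀ᵐ u ∂μ,
      ‖⟪z, u⟫ * (suppFn K u - t * ⟪z, u⟫) ^ (p - 1)‖ ≤ ‖z‖ * (2 * suppFn K u ^ (p - 1)) := by
    intro t ht
    filter_upwards [hμ, hpos] with u hu hu0
    have h1 : 0 ≤ suppFn K u - t * ⟪z, u⟫ :=
      le_trans (mul_nonneg (by linarith [ht.2]) hu0.le) (hK.mul_suppFn_le hz ht.1.le u)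
    rw [norm_mul, Real.norm_of_nonneg (Real.rpow_nonneg h1 _)]
    refine mul_le_mul ?_ (hK.rpow_suppFn_sub_le hp0 hp1 hz ht.1.le ht.2 hu0)
      (Real.rpow_nonneg h1 _) (norm_nonneg _)
    simpa [hu] using abs_real_inner_le_norm z u
  have hbi := ((hK.integrable_suppFn_rpow hμ hp0 hp1).const_mul 2).const_mul ‖z‖
  have hlim : Tendsto (fun t => ∫ u, ⟪z, u⟫ * (suppFn K u - t * ⟪z, u⟫) ^ (p - 1) ∂μ) (𝓝[>] 0)
      (𝓝 (∫ u, suppFn K u ^ (p - 1) * ⟪z, u⟫ ∂μ)) := by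
    refine tendsto_integral_filter_of_dominated_convergence _
      (Eventually.of_forall fun t => (hmeas t).aestronglyMeasurable) (hev.mono hb) hbi ?_
    filter_upwards [hpos] with u hu
    have h1 : Tendsto (fun t : ℝ => suppFn K u - t * ⟪z, u⟫) (𝓝[>] 0) (𝓝 (suppFn K u)) :=
      (Continuous.tendsto' (by fun_prop) _ _ (by simp)).mono_left nhdsWithin_le_nhds
    rw [mul_comm]
    exact (h1.rpow_const (Or.inl hu.ne')).const_mul _
  refine ge_of_tendsto hlim ?_
  filter_upwards [hev] with t ht
  refine hK.integral_inner_mul_rpow_nonneg hμ hp0 hp1 hz ht.1 (by linarith [ht.2]) ?_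
    (hbi.mono' (hmeas t).aestronglyMeasurable (hb t ht))
  filter_upwards [hpos] with u hu
  exact lt_of_lt_of_le (mul_pos (by linarith [ht.2]) hu) (hK.mul_suppFn_le hz ht.1.le u)

end IsMinimizer

end Optimality

section EulerLagrange

variable {m : ℕ} {K : Set (Eu (m + 1))} {p κ t : ℝ} {μ : Measure (Eu (m + 1))}
  {f : Eu (m + 1) → ℝ}

theorem recenter_perturb {K : Set (Eu (m + 1))} (hK : IsCompact K) (hne : K.Nonempty)
    (o : Eu (m + 1)) (f : Eu (m + 1) → ℝ) (t : ℝ) :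
    recenter (perturb K f t) o = perturb (recenter K o) f t := by
  ext x
  simp only [recenter, perturb, Set.mem_preimage, Set.mem_ofPred_eq]
  refine forall₂_congr fun u _ => ?_
  have := suppFn_recenter (o := o) hK hne u
  rw [recenter] at this
  rw [this, inner_add_left]
  constructor <;> intro h <;> linarith

/-- The moment vector `∫ h_K(u) ^ (p - 1) u dμ(u)`. -/
def moment (p : ℝ) (μ : Measure (Eu (m + 1))) (K : Set (Eu (m + 1))) : Eu (m + 1) :=
  ∫ u, suppFn K u ^ (p - 1) • u ∂μ

/-- The direction opposite to the moment vector. -/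
def momentDir (p : ℝ) (μ : Measure (Eu (m + 1))) (K : Set (Eu (m + 1))) : Eu (m + 1) :=
  -(‖moment p μ K‖⁻¹ • moment p μ K)

/-- The first variation at `K` of the energy, in the direction of `f`. -/
def firstVariation (p : ℝ) (μ : Measure (Eu (m + 1))) (K : Set (Eu (m + 1)))
    (f : Eu (m + 1) → ℝ) : ℝ :=
  ∫ u, suppFn K u ^ (p - 1) * f u ∂μ + ‖moment p μ K‖ * f (momentDir p μ K)

theorem inner_moment (x : Eu (m + 1)) :
    ⟪x, moment p μ K⟫ = -(‖moment p μ K‖ * ⟪x, momentDir p μ K⟫) := by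
  rw [momentDir, inner_neg_right, real_inner_smul_right]
  rcases eq_or_ne (moment p μ K) 0 with h | h
  · simp [h]
  · field_simp [norm_ne_zero_iff.2 h]

theorem norm_momentDir (h : moment p μ K ≠ 0) : ‖momentDir p μ K‖ = 1 := by
  rw [momentDir, norm_neg, norm_smul, norm_inv, norm_norm, inv_mul_cancel₀ (norm_ne_zero_iff.2 h)]

namespace IsMinimizer

theorem energy_pos (hK : IsMinimizer p μ κ K) (hκ : 0 < κ) : 0 < energy p μ K 0 := by
  rw [hK.energy_zero]
  exact mul_pos hκ hK.volume_pos

variable [IsFiniteMeasure μ]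

theorem inner_moment_eq_integral (hK : IsMinimizer p μ κ K) (hμ : ∀ᵐ u ∂μ, ‖u‖ = 1)
    (hp0 : 0 < p) (hp1 : p < 1) (z : Eu (m + 1)) :
    ⟪z, moment p μ K⟫ = ∫ u, suppFn K u ^ (p - 1) * ⟪z, u⟫ ∂μ := by
  have hint : Integrable (fun u => suppFn K u ^ (p - 1) • u) μ := by
    refine (hK.integrable_suppFn_rpow hμ hp0 hp1).mono'
      ((hK.continuous_suppFn.measurable.pow_const _).smul measurable_id).aestronglyMeasurable ?_
    filter_upwards [hμ] with u hu
    rw [norm_smul, hu, mul_one, Real.norm_of_nonneg (Real.rpow_nonneg (hK.suppFn_nonneg u) _)]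
  rw [moment, ← integral_inner hint]
  simp only [real_inner_smul_right]

theorem suppFn_momentDir (hK : IsMinimizer p μ κ K) (hμ : ∀ᵐ u ∂μ, ‖u‖ = 1)
    (hp0 : 0 < p) (hp1 : p < 1) : suppFn K (momentDir p μ K) = 0 := by
  refine le_antisymm (suppFn_le hK.nonempty fun x hx => ?_) (hK.suppFn_nonneg _)
  have h := hK.integral_suppFn_rpow_mul_inner_nonneg hμ hp0 hp1 hx
  rw [← hK.inner_moment_eq_integral hμ hp0 hp1] at h
  rw [momentDir, inner_neg_right, real_inner_smul_right]
  exact neg_nonpos.2 (mul_nonneg (by positivity) h)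

theorem neg_inner_moment_le (hK : IsMinimizer p μ κ K) (hμ : ∀ᵐ u ∂μ, ‖u‖ = 1)
    (hp0 : 0 < p) (hp1 : p < 1) {ξ : Eu (m + 1)} (hξ : ξ ∈ perturb K f t) :
    -⟪ξ, moment p μ K⟫ ≤ t * (‖moment p μ K‖ * f (momentDir p μ K)) := by
  rcases eq_or_ne (moment p μ K) 0 with h | h
  · simp [h]
  · have h1 := hξ _ (norm_momentDir h)
    rw [hK.suppFn_momentDir hμ hp0 hp1, zero_add] at h1
    rw [inner_moment, neg_neg]
    linarith [mul_le_mul_of_nonneg_left h1 (norm_nonneg (moment p μ K))]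

theorem energy_perturb_le (hK : IsMinimizer p μ κ K) (hμ : ∀ᵐ u ∂μ, ‖u‖ = 1)
    (hp0 : 0 < p) (hp1 : p < 1) (hf : Continuous f) (hL : IsCompact (perturb K f t))
    {ξ : Eu (m + 1)} (hξ : ξ ∈ perturb K f t) :
    energy p μ (perturb K f t) ξ ≤ energy p μ K 0 + p * (t * firstVariation p μ K f) := by
  have hi0 := integrable_energy hμ hp0 hK.isCompact hK.nonempty 0
  have hi1 := (hK.integrable_mul_suppFn_rpow hμ hp0 hp1 hf).const_mul t
  have hi2 := hK.integrable_mul_suppFn_rpow hμ hp0 hp1 (f := fun u => ⟪ξ, u⟫) (by fun_prop)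
  have hi3 : Integrable (fun u => p * (t * (suppFn K u ^ (p - 1) * f u) -
      suppFn K u ^ (p - 1) * ⟪ξ, u⟫)) μ := (hi1.sub hi2).const_mul p
  have h1 : energy p μ (perturb K f t) ξ ≤ energy p μ K 0 +
      p * (t * ∫ u, suppFn K u ^ (p - 1) * f u ∂μ - ∫ u, suppFn K u ^ (p - 1) * ⟪ξ, u⟫ ∂μ) := by
    rw [energy, energy, ← integral_const_mul, ← integral_sub hi1 hi2, ← integral_const_mul,
      ← integral_add hi0 hi3]
    refine integral_mono_ae (integrable_energy hμ hp0 hL ⟨ξ, hξ⟩ ξ)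
      (hi0.add hi3) ?_
    filter_upwards [hμ, hK.ae_suppFn_pos hμ hp0 hp1] with u hu hu0
    have h2 : suppFn (perturb K f t) u ≤ suppFn K u + t * f u :=
      suppFn_le ⟨ξ, hξ⟩ fun x hx => hx u hu
    have h3 := suppFn_sub_inner_nonneg hL hξ u
    have h4 := rpow_le_add_mul_sub hp0.le hp1.le hu0 h3
    have h5 : p * suppFn K u ^ (p - 1) * (suppFn (perturb K f t) u - ⟪ξ, u⟫ - suppFn K u) ≤
        p * suppFn K u ^ (p - 1) * (t * f u - ⟪ξ, u⟫) :=
      mul_le_mul_of_nonneg_left (by linarith) (by positivity)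
    simp only [inner_zero_left, sub_zero]
    linarith
  have h2 := hK.neg_inner_moment_le hμ hp0 hp1 hξ
  rw [hK.inner_moment_eq_integral hμ hp0 hp1] at h2
  refine h1.trans (add_le_add_right (mul_le_mul_of_nonneg_left ?_ hp0.le) _)
  rw [firstVariation, mul_add]
  linarith

theorem volume_perturb_le (hK : IsMinimizer p μ κ K) (hμ : ∀ᵐ u ∂μ, ‖u‖ = 1)
    (hp0 : 0 < p) (hp1 : p < 1) (hκ : 0 < κ) (hf : Continuous f) {o : Eu (m + 1)}
    (hL : IsCenteredBody (perturb (recenter K o) f t)) :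
    volume.real (perturb (recenter K o) f t) / volume.real K ≤
      (1 + p * (t * firstVariation p μ K f) / energy p μ K 0) ^ ((m + 1 : ℝ) / p) := by
  rw [← recenter_perturb hK.isCompact hK.nonempty] at hL ⊢
  rw [measureReal_def, volume_recenter, ← measureReal_def]
  set L := perturb K f t with hLdef
  have hLc : IsCompact L := by
    have h : L = (fun x => x + o) '' recenter L o := by
      rw [recenter, image_preimage_eq _ fun x => ⟨x - o, sub_add_cancel x o⟩]
    rw [h]
    exact hL.isCompact.image (by fun_prop)
  have hV : 0 < volume.real L := by
    have h : 0 < volume.real (recenter L o) :=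
      ENNReal.toReal_pos (Measure.measure_pos_of_mem_nhds volume hL.mem_nhds).ne'
        hL.isCompact.measure_ne_top
    rwa [measureReal_def, volume_recenter, ← measureReal_def] at h
  have hne : L.Nonempty := by
    rw [nonempty_iff_ne_empty]
    intro h
    simp [h] at hV
  obtain ⟨ξ, hξ, hmax⟩ := exists_energy_eq_maxEnergy hμ hp0 hp1 hLc hne
  have h1 := hK.le_maxEnergy L (convex_perturb K f t) hLc hV
  rw [← hmax] at h1
  have h2 := h1.trans (hK.energy_perturb_le hμ hp0 hp1 hf hLc hξ)
  have hM := hK.energy_pos hκ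
  have hX : 0 ≤ volume.real L / volume.real K := div_nonneg hV.le hK.volume_pos.le
  have h3 : (volume.real L / volume.real K) ^ (p / (m + 1)) ≤
      1 + p * (t * firstVariation p μ K f) / energy p μ K 0 := by
    rw [← mul_le_mul_iff_right₀ hM, mul_add, mul_div_cancel₀ _ hM.ne', mul_one]
    exact h2
  refine le_trans (le_of_eq ?_) (Real.rpow_le_rpow (Real.rpow_nonneg hX _) h3 (by positivity))
  rw [← Real.rpow_mul hX, div_mul_div_cancel₀ (by positivity), div_self hp0.ne', Real.rpow_one]

theorem integral_sphereMeasure_le (hK : IsMinimizer p μ κ K) (hμ : ∀ᵐ u ∂μ, ‖u‖ = 1)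
    (hp0 : 0 < p) (hp1 : p < 1) (hκ : 0 < κ) (hf : Continuous f) {o : Eu (m + 1)}
    (ho : o ∈ interior K) :
    ∫ u, f u ∂sphereMeasure (recenter K o) ≤ (m + 1) / κ * firstVariation p μ K f := by
  have hKo := isCenteredBody_recenter hK.convex hK.isCompact ho
  obtain ⟨r, hr0, hr⟩ := hKo.exists_ball_subset
  obtain ⟨C, hC⟩ := (isCompact_sphere (0 : Eu (m + 1)) 1).exists_bound_of_continuousOn
    hf.continuousOn
  set c := max C 0 / r with hc
  have hc0 : 0 ≤ c := by positivity
  have hfc : ∀ u, ‖u‖ = 1 → |f u| ≤ c * suppFn (recenter K o) u := by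
    intro u hu
    calc |f u| ≤ max C 0 := (hC u (by simpa using hu)).trans (le_max_left _ _)
      _ = c * r := by rw [hc, div_mul_cancel₀ _ hr0.ne']
      _ ≤ c * suppFn (recenter K o) u := mul_le_mul_of_nonneg_left (hKo.le_suppFn hr hu) hc0
  have hV := hK.volume_pos
  have hVo : volume.real (recenter K o) = volume.real K := by
    rw [measureReal_def, volume_recenter, ← measureReal_def]
  have hlim := (hKo.tendsto_slope_volume_perturb hc0 hf hfc).div_const (volume.real K)
  rw [hVo] at hlim
  set q := p * firstVariation p μ K f / energy p μ K 0 with hq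
  have hd : HasDerivAt (fun t : ℝ => (1 + q * t) ^ ((m + 1 : ℝ) / p))
      (q * ((m + 1 : ℝ) / p)) 0 := by
    have h1 : HasDerivAt (fun t : ℝ => 1 + q * t) q 0 := by
      simpa using ((hasDerivAt_id (0 : ℝ)).const_mul q).const_add 1
    simpa using h1.rpow_const (p := (m + 1 : ℝ) / p) (Or.inl (by simp))
  have hlim2 := (hasDerivAt_iff_tendsto_slope_zero.1 hd).mono_left
    (nhdsWithin_mono (0 : ℝ) (fun t (ht : t ∈ Ioi 0) => ne_of_gt ht))
  have hev : ∀ᶠ t : ℝ in 𝓝[>] 0, t * c < 1 :=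
    (Continuous.tendsto' (f := fun t : ℝ => t * c) (x := 0) (by fun_prop) 0
      (by simp)).mono_left nhdsWithin_le_nhds |>.eventually_lt_const one_pos
  have hle := le_of_tendsto_of_tendsto hlim hlim2 (by
    filter_upwards [hev, self_mem_nhdsWithin] with t ht (ht0 : 0 < t)
    have h := hK.volume_perturb_le hμ hp0 hp1 hκ hf
      (hKo.isCenteredBody_perturb hc0 hfc ht0.le ht)
    have h2 : p * (t * firstVariation p μ K f) / energy p μ K 0 = q * t := by
      rw [hq]
      ring
    rw [h2] at h
    rw [div_right_comm, sub_div, div_self hV.ne', div_eq_inv_mul _ t, zero_add, mul_zero,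
      add_zero, Real.one_rpow, smul_eq_mul]
    exact mul_le_mul_of_nonneg_left (by linarith) (by positivity))
  rw [div_le_iff₀ hV] at hle
  refine hle.trans_eq ?_
  rw [hq, hK.energy_zero]
  field_simp

theorem integral_sphereMeasure_eq (hK : IsMinimizer p μ κ K) (hμ : ∀ᵐ u ∂μ, ‖u‖ = 1)
    (hp0 : 0 < p) (hp1 : p < 1) (hκ : 0 < κ) (hf : Continuous f) {o : Eu (m + 1)}
    (ho : o ∈ interior K) :
    ∫ u, f u ∂sphereMeasure (recenter K o) = (m + 1) / κ * firstVariation p μ K f := by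
  refine le_antisymm (hK.integral_sphereMeasure_le hμ hp0 hp1 hκ hf ho) ?_
  have h := hK.integral_sphereMeasure_le hμ hp0 hp1 hκ (f := fun u => -f u) hf.neg ho
  have h2 : firstVariation p μ K (fun u => -f u) = -firstVariation p μ K f := by
    simp only [firstVariation, mul_neg, integral_neg]
    ring
  rw [integral_neg, h2] at h
  linarith

theorem sphereMeasure_eq (hK : IsMinimizer p μ κ K) (hμ : ∀ᵐ u ∂μ, ‖u‖ = 1)
    (hp0 : 0 < p) (hp1 : p < 1) (hκ : 0 < κ) {o : Eu (m + 1)} (ho : o ∈ interior K) :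
    sphereMeasure (recenter K o) = ENNReal.ofReal ((m + 1) / κ) •
      (μ.withDensity (fun u => ENNReal.ofReal (suppFn K u ^ (p - 1))) +
        ENNReal.ofReal ‖moment p μ K‖ • Measure.dirac (momentDir p μ K)) := by
  have hKo := isCenteredBody_recenter hK.convex hK.isCompact ho
  have := hKo.isFiniteMeasure_sphereMeasure
  have hden := isFiniteMeasure_withDensity_ofReal (hK.integrable_suppFn_rpow hμ hp0 hp1).2
  have hdir : IsFiniteMeasure
      (ENNReal.ofReal ‖moment p μ K‖ • Measure.dirac (momentDir p μ K)) :=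
    Measure.smul_finite _ ENNReal.ofReal_ne_top
  have hfin := Measure.smul_finite (μ.withDensity (fun u => ENNReal.ofReal (suppFn K u ^ (p - 1))) +
        ENNReal.ofReal ‖moment p μ K‖ • Measure.dirac (momentDir p μ K))
        (ENNReal.ofReal_ne_top (r := (m + 1) / κ))
  refine ext_of_forall_integral_eq_of_IsFiniteMeasure fun f => ?_
  rw [hK.integral_sphereMeasure_eq hμ hp0 hp1 hκ f.continuous ho, integral_smul_measure,
    integral_add_measure (f.integrable _) (f.integrable _), integral_smul_measure,
    integral_dirac, ENNReal.toReal_ofReal (by positivity), ENNReal.toReal_ofReal (norm_nonneg _),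
    integral_withDensity_eq_integral_toReal_smul
      (hK.continuous_suppFn.measurable.pow_const _).ennreal_ofReal (by simp)]
  simp only [ENNReal.toReal_ofReal (Real.rpow_nonneg (hK.suppFn_nonneg _) _), smul_eq_mul,
    firstVariation]

theorem lpSurf_eq (hK : IsMinimizer p μ κ K) (hμ : ∀ᵐ u ∂μ, ‖u‖ = 1)
    (hp0 : 0 < p) (hp1 : p < 1) (hκ : 0 < κ) {ω : Set (Eu (m + 1))} (hω : MeasurableSet ω) :
    lpSurf p K ω = hausdorffRatio m * ENNReal.ofReal ((m + 1) / κ) * μ ω := by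
  obtain ⟨o, ho⟩ := hK.interior_nonempty
  have hm : Measurable fun u => ENNReal.ofReal (suppFn K u ^ (1 - p)) :=
    (hK.continuous_suppFn.measurable.pow_const _).ennreal_ofReal
  have hm' : Measurable fun u => ENNReal.ofReal (suppFn K u ^ (p - 1)) :=
    (hK.continuous_suppFn.measurable.pow_const _).ennreal_ofReal
  have hdirac : ∫⁻ u in ω, ENNReal.ofReal (suppFn K u ^ (1 - p))
      ∂Measure.dirac (momentDir p μ K) = 0 := by
    rw [← nonpos_iff_eq_zero]
    refine (setLIntegral_le_lintegral _ _).trans_eq ?_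
    rw [lintegral_dirac' _ hm, hK.suppFn_momentDir hμ hp0 hp1,
      Real.zero_rpow (by linarith), ENNReal.ofReal_zero]
  have hden : ∫⁻ u in ω, ENNReal.ofReal (suppFn K u ^ (1 - p))
      ∂μ.withDensity (fun u => ENNReal.ofReal (suppFn K u ^ (p - 1))) = μ ω := by
    rw [setLIntegral_withDensity_eq_setLIntegral_mul _ hm' hm hω, ← setLIntegral_one]
    refine lintegral_congr_ae (ae_restrict_of_ae ?_)
    filter_upwards [hK.ae_suppFn_pos hμ hp0 hp1] with u hu
    rw [Pi.mul_apply, ← ENNReal.ofReal_mul (by positivity), ← Real.rpow_add hu]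
    simp
  rw [lpSurf_eq_lintegral hK.convex hK.isCompact ho p hω, hK.sphereMeasure_eq hμ hp0 hp1 hκ ho,
    Measure.restrict_smul, lintegral_smul_measure, Measure.restrict_add, lintegral_add_measure,
    Measure.restrict_smul, lintegral_smul_measure, hdirac, hden, smul_zero, add_zero, smul_eq_mul,
    mul_assoc]

end IsMinimizer

end EulerLagrange

/-- Chen, Li, Zhu: For `p ∈ (0,1)` and a non-trivial finite Borel measure `μ`
on the unit sphere of `ℝⁿ` that is not concentrated on a great subsphere, `μ` is the
`L_p`-surface area measure of a convex body containing the origin. -/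
theorem lp_minkowski_existence_zero_one
    (n : ℕ) (p : ℝ) (hp : p ∈ Set.Ioo (0:ℝ) 1)
    (μ : Measure (Eu n)) [IsFiniteMeasure μ] (hμ0 : μ ≠ 0)
    (hμsphere : μ (sphere (0 : Eu n) 1)ᶜ = 0)
    (hμnotgreat : ¬ ∃ L : Submodule ℝ (Eu n),
      Module.finrank ℝ L = n - 1 ∧ μ ((L : Set (Eu n))ᶜ) = 0) :
    ∃ K : Set (Eu n), IsConvexBody K ∧ (0 : Eu n) ∈ K ∧
      ∀ ω : Set (Eu n), MeasurableSet ω → μ ω = lpSurf p K ω := by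
  obtain ⟨hp0, hp1⟩ := hp
  have hμ : ∀ᵐ u ∂μ, ‖u‖ = 1 := by
    filter_upwards [mem_ae_iff.2 hμsphere] with u hu using mem_sphere_zero_iff_norm.1 hu
  rcases n with _ | m
  · refine absurd (ae_eq_bot.1 (eventually_false_iff_eq_bot.1 ?_)) hμ0
    filter_upwards [hμ] with u hu
    rw [Subsingleton.elim u 0, norm_zero] at hu
    exact zero_ne_one hu
  · set c : ℝ := (hausdorffRatio m).toReal with hc
    have hc0 : 0 < c :=
      ENNReal.toReal_pos (by simpa using hausdorffRatio_ne_zero m) (hausdorffRatio_ne_top m)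
    have hκ : 0 < (m + 1 : ℝ) * c := by positivity
    obtain ⟨K, hK⟩ := exists_isMinimizer hμ hp0 hp1 hμnotgreat hκ
    refine ⟨K, ⟨hK.convex, hK.isCompact, hK.interior_nonempty⟩, hK.zero_mem, fun ω hω => ?_⟩
    have h : (m + 1 : ℝ) / ((m + 1) * c) = c⁻¹ := by field_simp
    rw [hK.lpSurf_eq hμ hp0 hp1 hκ hω, h, ENNReal.ofReal_inv_of_pos hc0, hc,
      ENNReal.ofReal_toReal (hausdorffRatio_ne_top m), ENNReal.mul_inv_cancel
      (by simpa using hausdorffRatio_ne_zero m) (hausdorffRatio_ne_top m), one_mul]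

end
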